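/- arXiv:1705.04864 — 4 statements merged into one kernel-verified Lean document; each statement's English description precedes it below -/
import Mathlib

section
/- For every d ≥ 3 there exist constants ε_d > 0 and δ_d > 0 depending only on d such that the following holds: if w is a weight on S^{d-1} with w(S^{d-1}) = 1 and w(B) > 0 for every nonempty spherical cap B, and N is a positive integer with w(B(x, δ_d)) ≥ 1/N for all x ∈ S^{d-1}, then there exists a finite collection {S_1, …, S_m} of geodesic simplexes in S^{d-1}, each spanned by a strongly ε_d-separated set of d points, with pairwise disjoint interiors and union equal to S^{d-1}, such that N·w(S_j) is a positive integer for every 1 ≤ j ≤ m. -/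
open MeasureTheory Real Set
open scoped InnerProductSpace

noncomputable section

variable {d : ℕ}

/-- The unit sphere `S^{d-1}` of `ℝ^d`. -/
def unitSphere (d : ℕ) : Set (EuclideanSpace ℝ (Fin d)) :=
  Metric.sphere (0 : EuclideanSpace ℝ (Fin d)) 1

/-- The geodesic distance `dist(x,y) = arccos (x ⬝ y)`. -/
def gdist (x y : EuclideanSpace ℝ (Fin d)) : ℝ := Real.arccos ⟪x, y⟫_ℝ

/-- The spherical cap with center `x` and radius `r`. -/
def cap (x : EuclideanSpace ℝ (Fin d)) (r : ℝ) : Set (EuclideanSpace ℝ (Fin d)) :=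
  {y ∈ unitSphere d | gdist x y ≤ r}

/-- The surface Lebesgue measure on the unit sphere, realized as the
`(d-1)`-dimensional Hausdorff measure restricted to the sphere. -/
def sphMeasure (d : ℕ) : Measure (EuclideanSpace ℝ (Fin d)) :=
  (Measure.hausdorffMeasure ((d : ℝ) - 1)).restrict (unitSphere d)

/-- `w(A) = ∫_A w dσ_d`. -/
def wMass (w : EuclideanSpace ℝ (Fin d) → ℝ) (A : Set (EuclideanSpace ℝ (Fin d))) : ℝ :=
  ∫ x in A, w x ∂(sphMeasure d)

/-- Evaluation of a `d`-variate real polynomial at a point of `ℝ^d`. -/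
def pEval (P : MvPolynomial (Fin d) ℝ) (x : EuclideanSpace ℝ (Fin d)) : ℝ :=
  MvPolynomial.eval (fun i => x i) P

/-- The geodesic arc joining `x` and `y`. -/
def arcSeg (x y : EuclideanSpace ℝ (Fin d)) : Set (EuclideanSpace ℝ (Fin d)) :=
  {z ∈ unitSphere d | ∃ t₁ t₂ : ℝ, 0 ≤ t₁ ∧ 0 ≤ t₂ ∧ z = t₁ • x + t₂ • y}

/-- Geodesic convexity of a subset of the sphere. -/
def GeoConvex (A : Set (EuclideanSpace ℝ (Fin d))) : Prop :=
  ∀ x ∈ A, ∀ y ∈ A, arcSeg x y ⊆ A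

/-- The interior of a subset of the sphere relative to the sphere. -/
def sphInterior (A : Set (EuclideanSpace ℝ (Fin d))) : Set (EuclideanSpace ℝ (Fin d)) :=
  {x ∈ A | ∃ ε : ℝ, 0 < ε ∧ Metric.ball x ε ∩ unitSphere d ⊆ A}

/-- The geodesic simplex spanned by `ξ 0, …, ξ (d-1)`. -/
def geodSimplex (ξ : Fin d → EuclideanSpace ℝ (Fin d)) :
    Set (EuclideanSpace ℝ (Fin d)) :=
  {z | ∃ t : Fin d → ℝ, (∀ j, 0 ≤ t j) ∧ (∑ j, t j) = 1 ∧
    z = ‖∑ j, t j • ξ j‖⁻¹ • ∑ j, t j • ξ j}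

/-- An admissible family `ξ 0, …, ξ (d-1)` of points of the sphere (the indices
`0, 1, …, d-1` correspond to `ξ_1, ξ_2, …, ξ_d` in the paper). -/
def Admissible (ξ : Fin d → EuclideanSpace ℝ (Fin d)) : Prop :=
  LinearIndependent ℝ ξ ∧ (∀ j, ξ j ∈ unitSphere d) ∧
  (∀ i j : Fin d, 1 ≤ (i : ℕ) → 1 ≤ (j : ℕ) → i ≠ j → ⟪ξ i, ξ j⟫_ℝ = 0) ∧
  (∀ i j : Fin d, (i : ℕ) = 0 → (j : ℕ) = 1 →
    Real.arccos ⟪ξ i, ξ j⟫_ℝ ∈ Set.Icc (π / 6) (π / 2)) ∧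
  (∀ i j : Fin d, (i : ℕ) = 0 → 2 ≤ (j : ℕ) → ⟪ξ i, ξ j⟫_ℝ = 0)

/-- A strongly `ε`-separated family of points of the sphere. -/
def StronglySep (ε : ℝ) (η : Fin d → EuclideanSpace ℝ (Fin d)) : Prop :=
  Function.Injective η ∧ (∀ j, η j ∈ unitSphere d) ∧
  ∀ j : Fin d, ∀ y ∈ Submodule.span ℝ (η '' {i | i ≠ j}), ε ≤ ‖η j - y‖

/-- The reflection negating the last coordinate. -/
def lastNeg (d : ℕ) (x : EuclideanSpace ℝ (Fin d)) : EuclideanSpace ℝ (Fin d) :=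
  (EuclideanSpace.equiv (Fin d) ℝ).symm fun i => if (i : ℕ) = d - 1 then -(x i) else x i

/-- The gradient of a `d`-variate polynomial, as a vector of `ℝ^d`. -/
def polyGrad (P : MvPolynomial (Fin d) ℝ) (x : EuclideanSpace ℝ (Fin d)) :
    EuclideanSpace ℝ (Fin d) :=
  (EuclideanSpace.equiv (Fin d) ℝ).symm fun i =>
    MvPolynomial.eval (fun j => x j) (MvPolynomial.pderiv i P)

/-- The tangential gradient `∇₀P(x) = ∇P(x) − (x⬝∇P(x))·x`. -/
def tGrad (P : MvPolynomial (Fin d) ℝ) (x : EuclideanSpace ℝ (Fin d)) :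
    EuclideanSpace ℝ (Fin d) :=
  polyGrad P x - ⟪x, polyGrad P x⟫_ℝ • x

/-- The affine hyperplane through the points `ξ j`. -/
def hplane (ξ : Fin d → EuclideanSpace ℝ (Fin d)) : Set (EuclideanSpace ℝ (Fin d)) :=
  (affineSpan ℝ (Set.range ξ) : Set (EuclideanSpace ℝ (Fin d)))

/-- The ball `B(x,r)_H = {y ∈ H : ‖x − y‖ ≤ r}` in a hyperplane `H`. -/
def ballH (H : Set (EuclideanSpace ℝ (Fin d))) (x : EuclideanSpace ℝ (Fin d)) (r : ℝ) :
    Set (EuclideanSpace ℝ (Fin d)) :=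
  {y ∈ H | ‖x - y‖ ≤ r}

/-- `w(A) = ∫_A w` with respect to `(d−1)`-dimensional Hausdorff (surface) measure. -/
def hMass (w : EuclideanSpace ℝ (Fin d) → ℝ) (A : Set (EuclideanSpace ℝ (Fin d))) : ℝ :=
  ∫ x in A, w x ∂(Measure.hausdorffMeasure ((d : ℝ) - 1))

/-- The interior of `A` relative to a hyperplane `H`. -/
def hInterior (H A : Set (EuclideanSpace ℝ (Fin d))) : Set (EuclideanSpace ℝ (Fin d)) :=
  {x ∈ A | ∃ ε : ℝ, 0 < ε ∧ Metric.ball x ε ∩ H ⊆ A}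

/-- The unit sphere of a finite-dimensional inner product space of dimension `n + 1` has Hausdorff
dimension at most `n`. -/
theorem dimH_sphere_le {F : Type*} [NormedAddCommGroup F] [InnerProductSpace ℝ F]
    {n : ℕ} [Fact (Module.finrank ℝ F = n + 1)] :
    dimH (Metric.sphere (0 : F) 1) ≤ n := by
  have : FiniteDimensional ℝ F := .of_fact_finrank_eq_succ n
  rcases (Metric.sphere (0 : F) 1).eq_empty_or_nonempty with h | ⟨v, hv⟩
  · simp [h]
  have hv1 : ‖v‖ = 1 := by simpa using hv
  have hsub : Metric.sphere (0 : F) 1 ⊆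
      {v} ∪ range (fun w : (ℝ ∙ v)ᗮ => stereoInvFunAux v (w : F)) := by
    intro x hx
    by_cases hxv : x = v
    · exact Or.inl hxv
    · right
      have := stereo_left_inv hv1 (x := ⟨x, hx⟩) hxv
      exact ⟨stereoToFun v x, congrArg Subtype.val this⟩
  have hv0 : v ≠ 0 := by
    rintro rfl
    simp at hv1
  refine (dimH_mono hsub).trans ?_
  rw [dimH_union, dimH_singleton]
  refine max_le zero_le ?_
  have hsm : ContDiff ℝ 1 (fun w : (ℝ ∙ v)ᗮ => stereoInvFunAux v (w : F)) :=
    contDiff_stereoInvFunAux.comp (ℝ ∙ v)ᗮ.subtypeL.contDiff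
  refine hsm.dimH_range_le.trans ?_
  rw [Submodule.finrank_orthogonal_span_singleton (n := n) hv0]

theorem sphMeasure_hyperplane (hd : 2 ≤ d) (f : EuclideanSpace ℝ (Fin d) →ₗ[ℝ] ℝ) (hf : f ≠ 0) :
    sphMeasure d {x | f x = 0} = 0 := by
  have hms : MeasurableSet {x | f x = 0} :=
    (isClosed_eq f.continuous_of_finiteDimensional continuous_const).measurableSet
  rw [sphMeasure, Measure.restrict_apply hms]
  have hrank : Module.finrank ℝ (LinearMap.ker f) = (d - 2) + 1 := by
    have h1 := f.finrank_range_add_finrank_ker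
    rw [LinearMap.range_eq_top.2 (LinearMap.surjective_iff_ne_zero.2 hf)] at h1
    simp at h1
    omega
  have : Fact (Module.finrank ℝ (LinearMap.ker f) = (d - 2) + 1) := ⟨hrank⟩
  have hset : {x | f x = 0} ∩ unitSphere d =
      (LinearMap.ker f).subtypeₗᵢ '' Metric.sphere (0 : LinearMap.ker f) 1 := by
    ext x
    constructor
    · rintro ⟨h1, h2⟩
      refine ⟨⟨x, h1⟩, ?_, rfl⟩
      simpa [unitSphere] using h2
    · rintro ⟨y, hy, rfl⟩
      refine ⟨y.2, ?_⟩
      simpa [unitSphere] using hy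
  have hdim : dimH ({x | f x = 0} ∩ unitSphere d) < ((d - 1 : ℕ) : NNReal) := by
    rw [hset, (LinearMap.ker f).subtypeₗᵢ.isometry.dimH_image]
    refine (dimH_sphere_le (n := d - 2)).trans_lt ?_
    norm_cast
    omega
  have := hausdorffMeasure_of_dimH_lt hdim
  have hcast : (((d - 1 : ℕ) : NNReal) : ℝ) = (d : ℝ) - 1 := by
    rw [NNReal.coe_natCast, Nat.cast_sub (by omega), Nat.cast_one]
  rwa [hcast] at this

/-- Rotating a hyperplane sweeps a region continuously, so some position cuts off an integral
multiple of `1 / N`. -/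
theorem exists_cut {E : Type*} [TopologicalSpace E] [MeasurableSpace E] [BorelSpace E]
    (ν : Measure E) [IsFiniteMeasure ν] {f h : E → ℝ} (hfc : Continuous f) (hhc : Continuous h)
    (hnull : ∀ t : ℝ, ν {x | f x = t * h x} = 0) {A : Set E} (hA : MeasurableSet A)
    (hpos : ∀ x ∈ A, 0 ≤ h x) {N : ℕ} (hN : 0 < N) {t₁ t₂ : ℝ} (ht : t₁ ≤ t₂)
    (hgap : 1 / (N : ℝ) ≤ ν.real (A ∩ {x | t₁ * h x ≤ f x ∧ f x < t₂ * h x})) :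
    ∃ t ∈ Icc t₁ t₂, ∃ n : ℤ, (N : ℝ) * ν.real (A ∩ {x | t * h x ≤ f x}) = n := by
  have hN' : (0 : ℝ) < N := by exact_mod_cast hN
  have hmeas : ∀ t : ℝ, MeasurableSet (A ∩ {x | t * h x ≤ f x}) := fun t =>
    hA.inter (isClosed_le (by fun_prop) hfc).measurableSet
  have hcont : Continuous fun t : ℝ => (N : ℝ) * ν.real (A ∩ {x | t * h x ≤ f x}) := by
    refine continuous_const.mul (continuous_iff_continuousAt.2 fun t₀ => ?_)
    refine (ENNReal.tendsto_toReal (measure_ne_top ν _)).comp ?_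
    refine tendsto_measure_of_ae_tendsto_indicator_of_isFiniteMeasure _ (hmeas t₀) hmeas ?_
    have : ∀ᵐ x ∂ν, f x ≠ t₀ * h x := measure_eq_zero_iff_ae_notMem.1 (hnull t₀)
    filter_upwards [this] with x hx
    have hct : Filter.Tendsto (fun t : ℝ => t * h x) (nhds t₀) (nhds (t₀ * h x)) :=
      Continuous.tendsto (by fun_prop) t₀
    rcases lt_or_gt_of_ne hx with hlt | hgt
    · filter_upwards [hct.eventually (lt_mem_nhds hlt)] with t ht
      simp only [mem_inter_iff, mem_ofPred_eq]
      exact ⟨fun h => absurd h.2 (not_le.2 ht), fun h => absurd h.2 (not_le.2 hlt)⟩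
    · filter_upwards [hct.eventually (gt_mem_nhds hgt)] with t ht
      simp only [mem_inter_iff, mem_ofPred_eq]
      exact ⟨fun h => ⟨h.1, hgt.le⟩, fun h => ⟨h.1, ht.le⟩⟩
  have hdiff : ν.real (A ∩ {x | t₂ * h x ≤ f x}) +
      ν.real (A ∩ {x | t₁ * h x ≤ f x ∧ f x < t₂ * h x}) ≤
        ν.real (A ∩ {x | t₁ * h x ≤ f x}) := by
    rw [← measureReal_union' _ (hmeas t₂)]
    · refine measureReal_mono ?_
      rintro x (hx | hx)
      · exact ⟨hx.1, le_trans (mul_le_mul_of_nonneg_right ht (hpos x hx.1)) hx.2⟩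
      · exact ⟨hx.1, hx.2.1⟩
    · rw [Set.disjoint_left]
      rintro x hx hx'
      exact absurd hx.2 (not_le.2 hx'.2.2)
  set g : ℝ → ℝ := fun t => (N : ℝ) * ν.real (A ∩ {x | t * h x ≤ f x}) with hg
  have h12 : g t₂ + 1 ≤ g t₁ := by
    have := mul_le_mul_of_nonneg_left hdiff hN'.le
    have h2 := mul_le_mul_of_nonneg_left hgap hN'.le
    rw [mul_one_div_cancel hN'.ne'] at h2
    simp only [hg]
    linarith
  have hmem : ((⌊g t₁⌋ : ℤ) : ℝ) ∈ Icc (g t₂) (g t₁) :=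
    ⟨by linarith [Int.lt_floor_add_one (g t₁)], Int.floor_le _⟩
  obtain ⟨t, htm, hteq⟩ := intermediate_value_Icc' ht hcont.continuousOn hmem
  exact ⟨t, htm, _, hteq⟩

/-- The coordinate system `L` distorts lengths by bounded factors. -/
structure CoordBound (K R : ℝ) (L : EuclideanSpace ℝ (Fin d) ≃ₗ[ℝ] (Fin d → ℝ)) : Prop where
  coord_le : ∀ x i, |L x i| ≤ K * ‖x‖
  norm_le : ∀ x B, (∀ i, |L x i| ≤ B) → ‖x‖ ≤ R * B

/-- The cone of points whose first `k` coordinates with respect to `L` are nonnegative. -/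
def coordCone (L : EuclideanSpace ℝ (Fin d) ≃ₗ[ℝ] (Fin d → ℝ)) (k : ℕ) :
    Set (EuclideanSpace ℝ (Fin d)) :=
  {x | ∀ i : Fin d, (i : ℕ) < k → 0 ≤ L x i}

/-- `A` is a finite union of simplicial cones with null overlaps whose `ν`-measures are integral
multiples of `1 / N`. -/
def HasIntegralFan (ν : Measure (EuclideanSpace ℝ (Fin d))) (N : ℕ) (K R : ℝ)
    (A : Set (EuclideanSpace ℝ (Fin d))) : Prop :=
  ∃ (ι : Type) (_ : Finite ι) (L : ι → EuclideanSpace ℝ (Fin d) ≃ₗ[ℝ] (Fin d → ℝ)),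
    (∀ j, CoordBound K R (L j)) ∧ (⋃ j, coordCone (L j) d) = A ∧
    (∀ i j, i ≠ j → ν (coordCone (L i) d ∩ coordCone (L j) d) = 0) ∧
    ∀ j, ∃ n : ℤ, (N : ℝ) * ν.real (coordCone (L j) d) = n

theorem continuous_coord (L : EuclideanSpace ℝ (Fin d) ≃ₗ[ℝ] (Fin d → ℝ)) (i : Fin d) :
    Continuous fun x => L x i :=
  (continuous_apply i).comp L.toLinearMap.continuous_of_finiteDimensional

theorem isClosed_coordCone (L : EuclideanSpace ℝ (Fin d) ≃ₗ[ℝ] (Fin d → ℝ)) (k : ℕ) :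
    IsClosed (coordCone L k) := by
  simp only [coordCone, ofPred_forall]
  exact isClosed_iInter fun i => isClosed_iInter fun _ =>
    isClosed_le continuous_const (continuous_coord L i)

theorem HasIntegralFan.union {ν : Measure (EuclideanSpace ℝ (Fin d))} {N : ℕ} {K R : ℝ}
    {A B : Set (EuclideanSpace ℝ (Fin d))} (hA : HasIntegralFan ν N K R A)
    (hB : HasIntegralFan ν N K R B) (hAB : ν (A ∩ B) = 0) :
    HasIntegralFan ν N K R (A ∪ B) := by
  obtain ⟨ι, _, L, hL, hLA, hLd, hLn⟩ := hA
  obtain ⟨κ, _, M, hM, hMB, hMd, hMn⟩ := hB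
  have hsubL : ∀ i, coordCone (L i) d ⊆ A := fun i => hLA ▸ subset_iUnion (fun j => coordCone (L j) d) i
  have hsubM : ∀ i, coordCone (M i) d ⊆ B := fun i => hMB ▸ subset_iUnion (fun j => coordCone (M j) d) i
  refine ⟨ι ⊕ κ, inferInstance, Sum.elim L M, ?_, ?_, ?_, ?_⟩
  · rintro (j | j)
    exacts [hL j, hM j]
  · rw [iUnion_sum]
    simp only [Sum.elim_inl, Sum.elim_inr, hLA, hMB]
  · rintro (i | i) (j | j) hij
    · exact hLd i j fun h => hij (h ▸ rfl)
    · exact measure_mono_null (inter_subset_inter (hsubL i) (hsubM j)) hAB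
    · refine measure_mono_null ?_ hAB
      rw [inter_comm]
      exact inter_subset_inter (hsubL j) (hsubM i)
    · exact hMd i j fun h => hij (h ▸ rfl)
  · rintro (j | j)
    exacts [hLn j, hMn j]

/-- An invertible change of two coordinates. -/
theorem CoordBound.exists_mix {K R : ℝ} (hK : 0 ≤ K)
    {L : EuclideanSpace ℝ (Fin d) ≃ₗ[ℝ] (Fin d → ℝ)} (hL : CoordBound K R L)
    {i j : Fin d} (hij : i ≠ j) {a b p q a' b' p' q' : ℝ}
    (h₁ : a' * a + b' * p = 1) (h₂ : a' * b + b' * q = 0)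
    (h₃ : p' * a + q' * p = 0) (h₄ : p' * b + q' * q = 1)
    (h₁' : a * a' + b * p' = 1) (h₂' : a * b' + b * q' = 0)
    (h₃' : p * a' + q * p' = 0) (h₄' : p * b' + q * q' = 1)
    (ha : |a| ≤ 2) (hb : |b| ≤ 2) (hp : |p| ≤ 2) (hq : |q| ≤ 2)
    (ha' : |a'| ≤ 2) (hb' : |b'| ≤ 2) (hp' : |p'| ≤ 2) (hq' : |q'| ≤ 2) :
    ∃ M : EuclideanSpace ℝ (Fin d) ≃ₗ[ℝ] (Fin d → ℝ), CoordBound (4 * K) (4 * R) M ∧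
      (∀ x, M x i = a * L x i + b * L x j) ∧ (∀ x, M x j = p * L x i + q * L x j) ∧
      ∀ x l, l ≠ i → l ≠ j → M x l = L x l := by
  let mix : ℝ → ℝ → ℝ → ℝ → (Fin d → ℝ) →ₗ[ℝ] (Fin d → ℝ) := fun a b p q =>
    LinearMap.pi fun l =>
      if l = i then a • LinearMap.proj i + b • LinearMap.proj j
      else if l = j then p • LinearMap.proj i + q • LinearMap.proj j else LinearMap.proj l
  have mixi : ∀ a b p q c, mix a b p q c i = a * c i + b * c j := by
    intro a b p q c
    simp [mix]
  have mixj : ∀ a b p q c, mix a b p q c j = p * c i + q * c j := by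
    intro a b p q c
    simp [mix, hij.symm]
  have mixl : ∀ a b p q c l, l ≠ i → l ≠ j → mix a b p q c l = c l := by
    intro a b p q c l hi hj
    simp [mix, hi, hj]
  have inv : ∀ {a b p q a' b' p' q' : ℝ}, a' * a + b' * p = 1 → a' * b + b' * q = 0 →
      p' * a + q' * p = 0 → p' * b + q' * q = 1 →
      mix a' b' p' q' ∘ₗ mix a b p q = LinearMap.id := by
    intro a b p q a' b' p' q' h₁ h₂ h₃ h₄
    refine LinearMap.ext fun c => funext fun l => ?_
    simp only [LinearMap.comp_apply, LinearMap.id_apply]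
    by_cases hi : l = i
    · subst hi
      rw [mixi, mixi, mixj]
      linear_combination c l * h₁ + c j * h₂
    by_cases hj : l = j
    · subst hj
      rw [mixj, mixi, mixj]
      linear_combination c i * h₃ + c l * h₄
    rw [mixl _ _ _ _ _ _ hi hj, mixl _ _ _ _ _ _ hi hj]
  let S : (Fin d → ℝ) ≃ₗ[ℝ] (Fin d → ℝ) :=
    LinearEquiv.ofLinearMap (mix a b p q) (mix a' b' p' q') (inv h₁' h₂' h₃' h₄') (inv h₁ h₂ h₃ h₄)
  have bound : ∀ {s t u v B : ℝ}, |s| ≤ 2 → |t| ≤ 2 → |u| ≤ B → |v| ≤ B →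
      |s * u + t * v| ≤ 4 * B := by
    intro s t u v B hs ht hu hv
    refine (abs_add_le _ _).trans ?_
    rw [abs_mul, abs_mul]
    have hB : 0 ≤ B := (abs_nonneg u).trans hu
    have e1 := mul_le_mul hs hu (abs_nonneg u) (by norm_num)
    have e2 := mul_le_mul ht hv (abs_nonneg v) (by norm_num)
    linarith
  have hMi : ∀ x, (L.trans S) x i = a * L x i + b * L x j := fun x => mixi a b p q (L x)
  have hMj : ∀ x, (L.trans S) x j = p * L x i + q * L x j := fun x => mixj a b p q (L x)
  have hMl : ∀ x l, l ≠ i → l ≠ j → (L.trans S) x l = L x l := fun x l => mixl a b p q (L x) l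
  refine ⟨L.trans S, ⟨fun x l => ?_, fun x B hB => ?_⟩, hMi, hMj, hMl⟩
  · have hxi := hL.coord_le x i
    have hxj := hL.coord_le x j
    rw [mul_assoc]
    by_cases hi : l = i
    · rw [hi, hMi]
      exact bound ha hb hxi hxj
    by_cases hj : l = j
    · rw [hj, hMj]
      exact bound hp hq hxi hxj
    rw [hMl x l hi hj]
    linarith [hL.coord_le x l, mul_nonneg hK (norm_nonneg x)]
  · have hB0 : 0 ≤ B := (abs_nonneg _).trans (hB i)
    rw [mul_assoc, mul_left_comm]
    refine hL.norm_le x (4 * B) fun l => ?_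
    by_cases hi : l = i
    · have : L x i = a' * (L.trans S) x i + b' * (L.trans S) x j := by
        rw [hMi, hMj]
        linear_combination -L x i * h₁ - L x j * h₂
      rw [hi, this]
      exact bound ha' hb' (hB i) (hB j)
    by_cases hj : l = j
    · have : L x j = p' * (L.trans S) x i + q' * (L.trans S) x j := by
        rw [hMi, hMj]
        linear_combination -L x i * h₃ - L x j * h₄
      rw [hj, this]
      exact bound hp' hq' (hB i) (hB j)
    rw [← hMl x l hi hj]
    linarith [hB l]

theorem CoordBound.mono {K R K' R' : ℝ} {L : EuclideanSpace ℝ (Fin d) ≃ₗ[ℝ] (Fin d → ℝ)}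
    (hL : CoordBound K R L) (hK : K ≤ K') (hR : R ≤ R') (hd : 0 < d) : CoordBound K' R' L :=
  ⟨fun x i => (hL.coord_le x i).trans (mul_le_mul_of_nonneg_right hK (norm_nonneg x)),
    fun x B hB => (hL.norm_le x B hB).trans
      (mul_le_mul_of_nonneg_right hR ((abs_nonneg _).trans (hB ⟨0, hd⟩)))⟩

theorem norm_sub_le_of_mem_cap {x y : EuclideanSpace ℝ (Fin d)} {r : ℝ} (hx : x ∈ unitSphere d)
    (hy : y ∈ cap x r) : ‖y - x‖ ≤ r := by
  have hx1 : ‖x‖ = 1 := by simpa [unitSphere] using hx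
  have hy1 : ‖y‖ = 1 := by simpa [unitSphere] using hy.1
  have hr : gdist x y ≤ r := hy.2
  have h0 : 0 ≤ gdist x y := Real.arccos_nonneg _
  have habs : |⟪x, y⟫_ℝ| ≤ 1 := by simpa [hx1, hy1] using abs_real_inner_le_norm x y
  have hcos : Real.cos (gdist x y) = ⟪x, y⟫_ℝ :=
    Real.cos_arccos (abs_le.1 habs).1 (abs_le.1 habs).2
  have hsq : ‖y - x‖ ^ 2 ≤ gdist x y ^ 2 := by
    rw [norm_sub_sq_real, real_inner_comm, ← hcos, hx1, hy1]
    linarith [Real.one_sub_sq_div_two_le_cos (x := gdist x y)]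
  exact (le_of_sq_le_sq hsq h0).trans hr

/-- Every ray with bounded nonzero coordinates is the axis of a spherical cap on which the
coordinates are proportional to nearly the same values. -/
theorem CoordBound.exists_cap {K R δ : ℝ} (hR : 0 ≤ R) (hK : 0 ≤ K)
    {L : EuclideanSpace ℝ (Fin d) ≃ₗ[ℝ] (Fin d → ℝ)} (hL : CoordBound K R L)
    (hδ : 20 * δ * K * R ≤ 1) {a : Fin d → ℝ} (ha : ∀ i, |a i| ≤ 2) (ha0 : a ≠ 0) :
    ∃ ξ ∈ unitSphere d, ∀ y ∈ cap ξ δ, ∃ s : ℝ, 0 < s ∧ ∀ i, |s * L y i - a i| ≤ 1 / 10 := by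
  set x := L.symm a with hx
  have hx0 : x ≠ 0 := by simpa [hx] using ha0
  have hs : 0 < ‖x‖ := norm_pos_iff.2 hx0
  have hxR : ‖x‖ ≤ R * 2 := hL.norm_le x 2 (by simpa [hx] using ha)
  have hξ : ‖x‖⁻¹ • x ∈ unitSphere d := by
    simp [unitSphere, norm_smul, hs.ne']
  refine ⟨_, hξ, fun y hy => ⟨‖x‖, hs, fun i => ?_⟩⟩
  have hyx := norm_sub_le_of_mem_cap hξ hy
  have hδ0 : 0 ≤ δ := (norm_nonneg _).trans hyx
  have e : ‖x‖ * L y i - a i = ‖x‖ * L (y - ‖x‖⁻¹ • x) i := by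
    have : L x = a := by simp [hx]
    simp [this]
    field_simp
  rw [e, abs_mul, abs_of_pos hs]
  calc ‖x‖ * |L (y - ‖x‖⁻¹ • x) i| ≤ (R * 2) * (K * δ) := by
        refine mul_le_mul hxR ((hL.coord_le _ i).trans ?_) (abs_nonneg _) (by positivity)
        exact mul_le_mul_of_nonneg_left hyx hK
    _ ≤ 1 / 10 := by linarith

theorem CoordBound.one_div_le_measureReal {ν : Measure (EuclideanSpace ℝ (Fin d))}
    [IsFiniteMeasure ν] {N : ℕ} {δ K R : ℝ}
    (hcap : ∀ ξ ∈ unitSphere d, 1 / (N : ℝ) ≤ ν.real (cap ξ δ)) (hK : 0 ≤ K) (hR : 0 ≤ R)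
    {L : EuclideanSpace ℝ (Fin d) ≃ₗ[ℝ] (Fin d → ℝ)} (hL : CoordBound K R L)
    (hδ : 20 * δ * K * R ≤ 1) {a : Fin d → ℝ} (ha : ∀ i, |a i| ≤ 2) (ha0 : a ≠ 0)
    {A : Set (EuclideanSpace ℝ (Fin d))}
    (hA : ∀ y, ∀ s : ℝ, 0 < s → (∀ i, |s * L y i - a i| ≤ 1 / 10) → y ∈ A) :
    1 / (N : ℝ) ≤ ν.real A := by
  obtain ⟨ξ, hξ, h⟩ := hL.exists_cap hR hK hδ ha ha0
  refine (hcap ξ hξ).trans (measureReal_mono fun y hy => ?_)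
  obtain ⟨s, hs, hys⟩ := h y hy
  exact hA y s hs hys

theorem CoordBound.one_div_le_measureReal_coordCone {ν : Measure (EuclideanSpace ℝ (Fin d))}
    [IsFiniteMeasure ν] {N : ℕ} {δ K R : ℝ} (hd : 0 < d)
    (hcap : ∀ ξ ∈ unitSphere d, 1 / (N : ℝ) ≤ ν.real (cap ξ δ)) (hK : 0 ≤ K) (hR : 0 ≤ R)
    {L : EuclideanSpace ℝ (Fin d) ≃ₗ[ℝ] (Fin d → ℝ)} (hL : CoordBound K R L)
    (hδ : 20 * δ * K * R ≤ 1) (k : ℕ) : 1 / (N : ℝ) ≤ ν.real (coordCone L k) := by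
  refine hL.one_div_le_measureReal hcap hK hR hδ (a := fun _ => 1) (by simp)
    (fun h => one_ne_zero (congrFun h ⟨0, hd⟩)) fun y s hs h i _ => ?_
  have := (abs_le.1 (h i)).1
  exact (pos_of_mul_pos_right (by linarith : 0 < s * L y i) hs.le).le

theorem coord_comb_ne_zero (L : EuclideanSpace ℝ (Fin d) ≃ₗ[ℝ] (Fin d → ℝ)) {i j : Fin d}
    (hij : i ≠ j) (t : ℝ) :
    ((LinearMap.proj j - t • LinearMap.proj i : (Fin d → ℝ) →ₗ[ℝ] ℝ) ∘ₗ L.toLinearMap) ≠ 0 := by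
  intro h
  have := LinearMap.congr_fun h (L.symm (Pi.single j 1))
  simp [hij] at this

theorem measure_coord_eq {ν : Measure (EuclideanSpace ℝ (Fin d))}
    (hnull : ∀ f : EuclideanSpace ℝ (Fin d) →ₗ[ℝ] ℝ, f ≠ 0 → ν {x | f x = 0} = 0)
    (L : EuclideanSpace ℝ (Fin d) ≃ₗ[ℝ] (Fin d → ℝ)) {i j : Fin d} (hij : i ≠ j) (t : ℝ) :
    ν {x | L x j = t * L x i} = 0 := by
  refine measure_mono_null (fun x hx => ?_) (hnull _ (coord_comb_ne_zero L hij t))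
  have hx' : L x j = t * L x i := hx
  simp [hx']

/-- A cone with integral measure can be subdivided into simplicial cones with integral measure. -/
theorem hasIntegralFan_coordCone {ν : Measure (EuclideanSpace ℝ (Fin d))} [IsFiniteMeasure ν]
    (hnull : ∀ f : EuclideanSpace ℝ (Fin d) →ₗ[ℝ] ℝ, f ≠ 0 → ν {x | f x = 0} = 0)
    {N : ℕ} (hN : 0 < N) {δ : ℝ} (hδ0 : 0 ≤ δ)
    (hcap : ∀ ξ ∈ unitSphere d, 1 / (N : ℝ) ≤ ν.real (cap ξ δ)) (n : ℕ) :
    ∀ (k : ℕ) (K R : ℝ) (L : EuclideanSpace ℝ (Fin d) ≃ₗ[ℝ] (Fin d → ℝ)), 1 ≤ k → k + n = d →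
      0 ≤ K → 0 ≤ R → CoordBound K R L → 20 * δ * (4 ^ n * K) * (4 ^ n * R) ≤ 1 →
      (∃ z : ℤ, (N : ℝ) * ν.real (coordCone L k) = z) →
      HasIntegralFan ν N (4 ^ n * K) (4 ^ n * R) (coordCone L k) := by
  induction n with
  | zero =>
    intro k K R L _ hkd _ _ hL _ hz
    obtain rfl : k = d := by omega
    refine ⟨Unit, inferInstance, fun _ => L, fun _ => by simpa using hL, iUnion_const _,
      fun i j hij => absurd rfl hij, fun _ => hz⟩
  | succ n ih =>
    intro k K R L hk hkd hK hR hL hδ hz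
    let i : Fin d := ⟨0, by omega⟩
    let j : Fin d := ⟨k, by omega⟩
    have hij : i ≠ j := by
      simp only [i, j, ne_eq, Fin.mk.injEq]
      omega
    have hpow : (1 : ℝ) ≤ 4 ^ (n + 1) := one_le_pow₀ (by norm_num)
    have hδ1 : 20 * δ * K * R ≤ 1 := by
      refine le_trans ?_ hδ
      gcongr
      · exact le_mul_of_one_le_left hK hpow
      · exact le_mul_of_one_le_left hR hpow
    have hgap : 1 / (N : ℝ) ≤
        ν.real (coordCone L k ∩ {x | -1 * L x i ≤ L x j ∧ L x j < 1 * L x i}) := by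
      refine hL.one_div_le_measureReal hcap hK hR hδ1
        (a := fun l => if l = j then 0 else 1) (fun l => ?_) (fun h => ?_) fun y s hs h => ?_
      · split_ifs <;> simp
      · simpa [hij] using congrFun h i
      · have hj := abs_le.1 (h j)
        have hi := abs_le.1 (h i)
        simp only [if_true, if_neg hij] at hj hi
        refine ⟨fun l hl => ?_, ?_, ?_⟩
        · have hlj : l ≠ j := by
            rintro rfl
            exact absurd hl (lt_irrefl k)
          have hl' := (abs_le.1 (h l)).1
          simp only [if_neg hlj] at hl'
          exact (pos_of_mul_pos_right (by linarith : 0 < s * L y l) hs.le).le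
        · exact le_of_mul_le_mul_left (by linarith : s * (-1 * L y i) ≤ s * L y j) hs
        · exact lt_of_mul_lt_mul_left (by linarith : s * L y j < s * (1 * L y i)) hs.le
    obtain ⟨t, ⟨ht1, ht2⟩, n₁, hn₁⟩ := exists_cut ν (continuous_coord L j) (continuous_coord L i)
      (measure_coord_eq hnull L hij) (isClosed_coordCone L k).measurableSet
      (fun x hx => hx i hk) hN (by norm_num : (-1 : ℝ) ≤ 1) hgap
    have htabs : |t| ≤ 2 := abs_le.2 ⟨by linarith, by linarith⟩
    obtain ⟨M, hM, hMi, hMj, hMl⟩ := hL.exists_mix hK hij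
      (a := 1) (b := 0) (p := -t) (q := 1) (a' := 1) (b' := 0) (p' := t) (q' := 1)
      (by ring) (by ring) (by ring) (by ring) (by ring) (by ring) (by ring) (by ring)
      (by norm_num) (by norm_num) (by rwa [abs_neg]) (by norm_num)
      (by norm_num) (by norm_num) htabs (by norm_num)
    obtain ⟨M', hM', hMi', hMj', hMl'⟩ := hL.exists_mix hK hij
      (a := 1) (b := 0) (p := t) (q := -1) (a' := 1) (b' := 0) (p' := t) (q' := -1)
      (by ring) (by ring) (by ring) (by ring) (by ring) (by ring) (by ring) (by ring)
      (by norm_num) (by norm_num) htabs (by norm_num)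
      (by norm_num) (by norm_num) htabs (by norm_num)
    have cone_succ : ∀ (P : EuclideanSpace ℝ (Fin d) ≃ₗ[ℝ] (Fin d → ℝ)),
        (∀ x, P x i = 1 * L x i + 0 * L x j) → (∀ x l, l ≠ i → l ≠ j → P x l = L x l) →
        coordCone P (k + 1) = coordCone L k ∩ {x | 0 ≤ P x j} := by
      intro P hPi hPl
      have hPL : ∀ x (l : Fin d), (l : ℕ) < k → P x l = L x l := by
        intro x l hl
        by_cases hli : l = i
        · rw [hli, hPi]
          ring
        · refine hPl x l hli ?_
          rintro rfl
          exact absurd hl (lt_irrefl k)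
      ext x
      constructor
      · exact fun hx => ⟨fun l hl => hPL x l hl ▸ hx l (by omega), hx j (Nat.lt_succ_self k)⟩
      · rintro ⟨hx, hxj⟩ l hl
        rcases Nat.lt_succ_iff_lt_or_eq.1 hl with h | h
        · exact (hPL x l h).symm ▸ hx l h
        · obtain rfl : l = j := Fin.ext h
          exact hxj
    have hcM : coordCone M (k + 1) = coordCone L k ∩ {x | t * L x i ≤ L x j} := by
      rw [cone_succ M hMi hMl]
      congr 1
      ext x
      simp only [mem_ofPred_eq, hMj]
      constructor <;> intro h <;> linarith
    have hcM' : coordCone M' (k + 1) = coordCone L k ∩ {x | L x j ≤ t * L x i} := by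
      rw [cone_succ M' hMi' hMl']
      congr 1
      ext x
      simp only [mem_ofPred_eq, hMj']
      constructor <;> intro h <;> linarith
    have hunion : coordCone M (k + 1) ∪ coordCone M' (k + 1) = coordCone L k := by
      rw [hcM, hcM', ← inter_union_distrib_left, inter_eq_left]
      exact fun x _ => le_total (t * L x i) (L x j)
    have hinter : ν (coordCone M (k + 1) ∩ coordCone M' (k + 1)) = 0 := by
      refine measure_mono_null ?_ (measure_coord_eq hnull L hij t)
      rw [hcM, hcM']
      rintro x ⟨⟨_, h1⟩, _, h2⟩
      exact le_antisymm h2 h1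
    have hsum : ν.real (coordCone L k) =
        ν.real (coordCone M (k + 1)) + ν.real (coordCone M' (k + 1)) := by
      rw [← hunion]
      exact measureReal_union₀ (isClosed_coordCone M' _).measurableSet.nullMeasurableSet hinter
    have hδ2 : 20 * δ * (4 ^ n * (4 * K)) * (4 ^ n * (4 * R)) ≤ 1 := by
      rw [pow_succ] at hδ
      linarith
    rw [← hunion, pow_succ, mul_assoc, mul_assoc]
    refine (ih (k + 1) (4 * K) (4 * R) M (by omega) (by omega) (by positivity) (by positivity)
      hM hδ2 ⟨n₁, by rw [hcM, hn₁]⟩).union (ih (k + 1) (4 * K) (4 * R) M' (by omega) (by omega)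
      (by positivity) (by positivity) hM' hδ2 ?_) hinter
    obtain ⟨z, hz⟩ := hz
    refine ⟨z - n₁, ?_⟩
    rw [hsum, hcM, mul_add, hn₁] at hz
    push_cast
    linarith

theorem coordCone_two (L : EuclideanSpace ℝ (Fin d) ≃ₗ[ℝ] (Fin d → ℝ)) {i j : Fin d}
    (hi : (i : ℕ) = 0) (hj : (j : ℕ) = 1) : coordCone L 2 = {x | 0 ≤ L x i ∧ 0 ≤ L x j} := by
  ext x
  refine ⟨fun h => ⟨h i (by omega), h j (by omega)⟩, fun h l hl => ?_⟩
  rcases Nat.lt_succ_iff_lt_or_eq.1 hl with h' | h'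
  · obtain rfl : l = i := Fin.ext (by omega)
    exact h.1
  · obtain rfl : l = j := Fin.ext (by omega)
    exact h.2

/-- The whole space splits into three sectors with integral measure, and then into simplicial
cones. -/
theorem hasIntegralFan_univ {ν : Measure (EuclideanSpace ℝ (Fin d))} [IsFiniteMeasure ν]
    (hnull : ∀ f : EuclideanSpace ℝ (Fin d) →ₗ[ℝ] ℝ, f ≠ 0 → ν {x | f x = 0} = 0)
    (huniv : ν.real univ = 1) {N : ℕ} (hN : 0 < N) {δ : ℝ} (hδ0 : 0 ≤ δ)
    (hcap : ∀ ξ ∈ unitSphere d, 1 / (N : ℝ) ≤ ν.real (cap ξ δ)) {n : ℕ} (hn : 2 + n = d)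
    {K R : ℝ} (hK : 0 ≤ K) (hR : 0 ≤ R) {L : EuclideanSpace ℝ (Fin d) ≃ₗ[ℝ] (Fin d → ℝ)}
    (hL : CoordBound K R L) (hδ : 20 * δ * (4 ^ n * (4 * K)) * (4 ^ n * (4 * R)) ≤ 1) :
    HasIntegralFan ν N (4 ^ n * (4 * K)) (4 ^ n * (4 * R)) univ := by
  let i : Fin d := ⟨0, by omega⟩
  let j : Fin d := ⟨1, by omega⟩
  have hij : i ≠ j := by simp [i, j]
  have hδ1 : 20 * δ * K * R ≤ 1 := by
    refine le_trans ?_ hδ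
    have hpow : (1 : ℝ) ≤ 4 ^ n := one_le_pow₀ (by norm_num)
    gcongr
    · exact (by linarith : K ≤ 4 * K).trans (le_mul_of_one_le_left (by linarith) hpow)
    · exact (by linarith : R ≤ 4 * R).trans (le_mul_of_one_le_left (by linarith) hpow)
  have gap : ∀ σ : ℝ, |σ| = 1 → 1 / (N : ℝ) ≤ ν.real ({x | 0 ≤ σ * L x i} ∩
      {x | -2 * (σ * L x i) ≤ L x j ∧ L x j < -1 * (σ * L x i)}) := by
    intro σ hσ
    have hσ2 : σ * σ = 1 := by rw [← abs_mul_abs_self, hσ, one_mul]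
    refine hL.one_div_le_measureReal hcap hK hR hδ1
      (a := fun l => if l = j then -(3 / 2) else σ) (fun l => ?_) (fun h => ?_)
      fun y s hs h => ?_
    · split_ifs
      · norm_num [abs_div]
      · rw [hσ]
        norm_num
    · have := congrFun h j
      norm_num at this
    · have hj := abs_le.1 (h j)
      have hi : |s * (σ * L y i) - 1| ≤ 1 / 10 := by
        have e : s * (σ * L y i) - 1 = σ * (s * L y i - σ) := by linear_combination hσ2
        rw [e, abs_mul, hσ, one_mul]
        simpa [hij] using h i
      have hi := abs_le.1 hi
      simp only [if_true] at hj
      refine ⟨(pos_of_mul_pos_right (by linarith : 0 < s * (σ * L y i)) hs.le).le, ?_, ?_⟩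
      · exact le_of_mul_le_mul_left
          (by linarith : s * (-2 * (σ * L y i)) ≤ s * L y j) hs
      · exact lt_of_mul_lt_mul_left
          (by linarith : s * L y j < s * (-1 * (σ * L y i))) hs.le
  have cut : ∀ σ : ℝ, |σ| = 1 → ∃ t ∈ Icc (-2 : ℝ) (-1), ∃ z : ℤ, (N : ℝ) *
      ν.real ({x | 0 ≤ σ * L x i} ∩ {x | t * (σ * L x i) ≤ L x j}) = z := by
    intro σ hσ
    have hc : Continuous fun x => σ * L x i := continuous_const.mul (continuous_coord L i)
    refine exists_cut ν (continuous_coord L j) hc (fun t => ?_)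
      (isClosed_le continuous_const hc).measurableSet (fun x hx => hx) hN (by norm_num)
      (gap σ hσ)
    simpa only [mul_assoc] using measure_coord_eq hnull L hij (t * σ)
  obtain ⟨t, ⟨ht1, ht2⟩, z, hz⟩ := cut 1 (by simp)
  obtain ⟨u, ⟨hu1, hu2⟩, z', hz'⟩ := cut (-1) (by simp)
  have ht : |t| ≤ 2 := abs_le.2 ⟨by linarith, by linarith⟩
  have hu : |u| ≤ 2 := abs_le.2 ⟨by linarith, by linarith⟩
  have hneg : t + u < 0 := by linarith
  have hne : t + u ≠ 0 := hneg.ne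
  have hdiv : ∀ r : ℝ, |r| ≤ 2 → |r / (t + u)| ≤ 2 := by
    intro r hr
    rw [abs_div, abs_of_neg hneg, div_le_iff₀ (by linarith)]
    linarith
  obtain ⟨M₁, hM₁, hM₁i, hM₁j, -⟩ := hL.exists_mix hK hij
    (a := 1) (b := 0) (p := -t) (q := 1) (a' := 1) (b' := 0) (p' := t) (q' := 1)
    (by ring) (by ring) (by ring) (by ring) (by ring) (by ring) (by ring) (by ring)
    (by norm_num) (by norm_num) (by rwa [abs_neg]) (by norm_num)
    (by norm_num) (by norm_num) ht (by norm_num)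
  obtain ⟨M₂, hM₂, hM₂i, hM₂j, -⟩ := hL.exists_mix hK hij
    (a := -1) (b := 0) (p := u) (q := 1) (a' := -1) (b' := 0) (p' := u) (q' := 1)
    (by ring) (by ring) (by ring) (by ring) (by ring) (by ring) (by ring) (by ring)
    (by norm_num) (by norm_num) hu (by norm_num)
    (by norm_num) (by norm_num) hu (by norm_num)
  obtain ⟨M₃, hM₃, hM₃i, hM₃j, -⟩ := hL.exists_mix hK hij
    (a := u / (t + u)) (b := 1 / (t + u)) (p := (-t) / (t + u)) (q := 1 / (t + u))
    (a' := 1) (b' := -1) (p' := t) (q' := u)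
    (by field_simp; ring) (by field_simp; ring) (by field_simp; ring) (by field_simp)
    (by field_simp; ring) (by field_simp; ring) (by field_simp; ring) (by field_simp)
    (hdiv u hu) (hdiv 1 (by norm_num)) (hdiv (-t) (by rwa [abs_neg])) (hdiv 1 (by norm_num))
    (by norm_num) (by norm_num) ht hu
  have hc₁ : coordCone M₁ 2 = {x | 0 ≤ 1 * L x i} ∩ {x | t * (1 * L x i) ≤ L x j} := by
    rw [coordCone_two M₁ (i := i) (j := j) rfl rfl]
    ext x
    simp only [mem_ofPred_eq, mem_inter_iff, hM₁i, hM₁j]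
    constructor <;> rintro ⟨h1, h2⟩ <;> constructor <;> linarith
  have hc₂ : coordCone M₂ 2 = {x | 0 ≤ -1 * L x i} ∩ {x | u * (-1 * L x i) ≤ L x j} := by
    rw [coordCone_two M₂ (i := i) (j := j) rfl rfl]
    ext x
    simp only [mem_ofPred_eq, mem_inter_iff, hM₂i, hM₂j]
    constructor <;> rintro ⟨h1, h2⟩ <;> constructor <;> linarith
  have hc₃ : coordCone M₃ 2 = {x | L x j ≤ -u * L x i ∧ L x j ≤ t * L x i} := by
    rw [coordCone_two M₃ (i := i) (j := j) rfl rfl]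
    ext x
    simp only [mem_ofPred_eq, hM₃i, hM₃j]
    have e1 : u / (t + u) * L x i + 1 / (t + u) * L x j = (u * L x i + L x j) / (t + u) := by
      field_simp
    have e2 : -t / (t + u) * L x i + 1 / (t + u) * L x j = (-t * L x i + L x j) / (t + u) := by
      field_simp
    rw [e1, e2, le_div_iff_of_neg hneg, le_div_iff_of_neg hneg]
    constructor <;> rintro ⟨h1, h2⟩ <;> constructor <;> linarith
  have hd₁₂ : ν (coordCone M₁ 2 ∩ coordCone M₂ 2) = 0 := by
    refine measure_mono_null ?_ (measure_coord_eq hnull L hij.symm 0)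
    rw [hc₁, hc₂]
    rintro x ⟨⟨h1, _⟩, h2, _⟩
    rw [mem_ofPred_eq] at h1 h2 ⊢
    linarith
  have hd₃ : ν ((coordCone M₁ 2 ∪ coordCone M₂ 2) ∩ coordCone M₃ 2) = 0 := by
    refine measure_mono_null ?_
      (measure_union_null (measure_coord_eq hnull L hij t) (measure_coord_eq hnull L hij (-u)))
    rw [hc₁, hc₂, hc₃]
    rintro x ⟨⟨_, h1⟩ | ⟨_, h1⟩, h2, h3⟩
    · left
      rw [mem_ofPred_eq] at h1 ⊢
      linarith
    · right
      rw [mem_ofPred_eq] at h1 ⊢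
      linarith
  have hcover : (coordCone M₁ 2 ∪ coordCone M₂ 2) ∪ coordCone M₃ 2 = univ := by
    rw [eq_univ_iff_forall, hc₁, hc₂, hc₃]
    intro x
    simp only [mem_union, mem_inter_iff, mem_ofPred_eq]
    rcases le_total 0 (L x i) with h0 | h0
    · by_cases h1 : t * L x i ≤ L x j
      · exact Or.inl (Or.inl ⟨by linarith, by linarith⟩)
      · exact Or.inr ⟨by nlinarith, by linarith⟩
    · by_cases h1 : -u * L x i ≤ L x j
      · exact Or.inl (Or.inr ⟨by linarith, by linarith⟩)
      · exact Or.inr ⟨by linarith, by nlinarith⟩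
  have hsum : ν.real (coordCone M₁ 2) + ν.real (coordCone M₂ 2) + ν.real (coordCone M₃ 2) = 1 := by
    rw [← huniv, ← hcover,
      measureReal_union₀ (isClosed_coordCone M₃ _).measurableSet.nullMeasurableSet hd₃,
      measureReal_union₀ (isClosed_coordCone M₂ _).measurableSet.nullMeasurableSet hd₁₂]
  have fan : ∀ M, CoordBound (4 * K) (4 * R) M →
      (∃ z : ℤ, (N : ℝ) * ν.real (coordCone M 2) = z) →
      HasIntegralFan ν N (4 ^ n * (4 * K)) (4 ^ n * (4 * R)) (coordCone M 2) := fun M hM =>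
    hasIntegralFan_coordCone hnull hN hδ0 hcap n 2 (4 * K) (4 * R) M (by norm_num) hn
      (by positivity) (by positivity) hM hδ
  rw [← hcover]
  rw [← hc₁] at hz
  rw [← hc₂] at hz'
  refine ((fan M₁ hM₁ ⟨z, hz⟩).union (fan M₂ hM₂ ⟨z', hz'⟩) hd₁₂).union
    (fan M₃ hM₃ ⟨N - z - z', ?_⟩) hd₃
  push_cast
  rw [← hz, ← hz']
  linear_combination (N : ℝ) * hsum

theorem coordBound_ofLp : CoordBound (d := d) 1 (d : ℝ) (WithLp.linearEquiv 2 ℝ (Fin d → ℝ)) := by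
  refine ⟨fun x i => ?_, fun x B hB => ?_⟩
  · simpa using PiLp.norm_apply_le x i
  · have hx : x = ∑ i, x i • EuclideanSpace.single i (1 : ℝ) := by
      ext i
      simp [Finset.sum_apply, Pi.single_apply]
    rw [hx]
    refine (norm_sum_le _ _).trans ?_
    refine (Finset.sum_le_sum (g := fun _ => B) fun i _ => ?_).trans (by simp)
    rw [norm_smul, PiLp.norm_single, norm_one, mul_one]
    exact hB i

/-- The unit vectors spanning the cone `coordCone L d`. -/
def coneVertex (L : EuclideanSpace ℝ (Fin d) ≃ₗ[ℝ] (Fin d → ℝ)) (i : Fin d) :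
    EuclideanSpace ℝ (Fin d) :=
  ‖L.symm (Pi.single i 1)‖⁻¹ • L.symm (Pi.single i 1)

theorem norm_symm_single_pos (L : EuclideanSpace ℝ (Fin d) ≃ₗ[ℝ] (Fin d → ℝ)) (i : Fin d) :
    0 < ‖L.symm (Pi.single i 1)‖ := by
  rw [norm_pos_iff]
  simp

theorem coord_coneVertex (L : EuclideanSpace ℝ (Fin d) ≃ₗ[ℝ] (Fin d → ℝ)) (i j : Fin d) :
    L (coneVertex L i) j = if j = i then ‖L.symm (Pi.single i 1)‖⁻¹ else 0 := by
  simp [coneVertex, Pi.single_apply]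

theorem CoordBound.stronglySep {K R : ℝ} (hK : 0 < K) (hR : 0 < R)
    {L : EuclideanSpace ℝ (Fin d) ≃ₗ[ℝ] (Fin d → ℝ)} (hL : CoordBound K R L) :
    StronglySep (1 / (K * R)) (coneVertex L) := by
  refine ⟨fun i j hij => ?_, fun i => ?_, fun j y hy => ?_⟩
  · by_contra hne
    have h1 := coord_coneVertex L i i
    rw [hij, coord_coneVertex, if_neg hne, if_pos rfl] at h1
    exact (inv_pos.2 (norm_symm_single_pos L i)).ne h1
  · have := (norm_symm_single_pos L i).ne'
    simp [unitSphere, coneVertex, norm_smul, this]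
  · have hy0 : L y j = 0 := by
      have hle : Submodule.span ℝ (coneVertex L '' {i | i ≠ j}) ≤
          LinearMap.ker ((LinearMap.proj j : (Fin d → ℝ) →ₗ[ℝ] ℝ) ∘ₗ L.toLinearMap) := by
        rw [Submodule.span_le]
        rintro _ ⟨i, hi, rfl⟩
        have hi' : j ≠ i := fun h => hi h.symm
        simpa [hi'] using coord_coneVertex L i j
      exact hle hy
    have hb := hL.coord_le (coneVertex L j - y) j
    have hs := norm_symm_single_pos L j
    rw [map_sub, Pi.sub_apply, hy0, sub_zero, coord_coneVertex, if_pos rfl,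
      abs_of_pos (inv_pos.2 hs)] at hb
    have hsR : ‖L.symm (Pi.single j 1)‖ ≤ R * 1 := by
      refine hL.norm_le _ 1 fun l => ?_
      rw [LinearEquiv.apply_symm_apply, Pi.single_apply]
      split_ifs <;> simp
    have h2 : R⁻¹ ≤ ‖L.symm (Pi.single j 1)‖⁻¹ := inv_anti₀ hs (by linarith)
    rw [div_le_iff₀ (by positivity)]
    have h3 := mul_le_mul_of_nonneg_left (h2.trans hb) hR.le
    rw [mul_inv_cancel₀ hR.ne'] at h3
    linarith

theorem geodSimplex_coneVertex (L : EuclideanSpace ℝ (Fin d) ≃ₗ[ℝ] (Fin d → ℝ)) :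
    geodSimplex (coneVertex L) = coordCone L d ∩ unitSphere d := by
  have hcoord : ∀ (t : Fin d → ℝ) i,
      L (∑ j, t j • coneVertex L j) i = t i * ‖L.symm (Pi.single i 1)‖⁻¹ := by
    intro t i
    simp [map_sum, Finset.sum_apply, coord_coneVertex]
  have hpos := norm_symm_single_pos L
  ext z
  constructor
  · rintro ⟨t, ht, hsum, rfl⟩
    have hne : ∑ j, t j • coneVertex L j ≠ 0 := by
      intro h
      have ht0 : ∀ i, t i = 0 := by
        intro i
        have := hcoord t i
        rw [h, map_zero, Pi.zero_apply, eq_comm, mul_eq_zero] at this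
        exact this.resolve_right (inv_pos.2 (hpos i)).ne'
      simp [ht0] at hsum
    refine ⟨fun i _ => ?_, ?_⟩
    · rw [map_smul, Pi.smul_apply, hcoord, smul_eq_mul]
      exact mul_nonneg (by positivity) (mul_nonneg (ht i) (by positivity))
    · simp [unitSphere, norm_smul, hne]
  · rintro ⟨hz, hz1⟩
    have hz1 : ‖z‖ = 1 := by simpa [unitSphere] using hz1
    have hz0 : ∀ i, 0 ≤ L z i := fun i => hz i i.2
    set c : Fin d → ℝ := fun i => L z i * ‖L.symm (Pi.single i 1)‖ with hc
    have hc0 : ∀ i, 0 ≤ c i := fun i => mul_nonneg (hz0 i) (hpos i).le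
    have hcz : ∑ i, c i • coneVertex L i = z := by
      refine L.injective (funext fun i => ?_)
      rw [hcoord, hc]
      exact mul_inv_cancel_right₀ (hpos i).ne' _
    have hs : 0 < ∑ i, c i := by
      refine (Finset.sum_nonneg fun i _ => hc0 i).lt_of_ne fun h => ?_
      have hall := (Finset.sum_eq_zero_iff_of_nonneg fun i _ => hc0 i).1 h.symm
      have : z = 0 := by
        rw [← hcz]
        exact Finset.sum_eq_zero fun i hi => by rw [hall i hi, zero_smul]
      simp [this] at hz1
    have hsum : ∑ i, ((∑ i, c i)⁻¹ * c i) • coneVertex L i = (∑ i, c i)⁻¹ • z := by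
      simp only [mul_smul, ← Finset.smul_sum, hcz]
    refine ⟨fun i => (∑ i, c i)⁻¹ * c i, fun i => mul_nonneg (inv_pos.2 hs).le (hc0 i), ?_, ?_⟩
    · rw [← Finset.mul_sum, inv_mul_cancel₀ hs.ne']
    · rw [hsum, norm_smul, hz1, norm_inv, Real.norm_of_nonneg hs.le, mul_one, inv_inv,
        smul_smul, mul_inv_cancel₀ hs.ne', one_smul]

/-- The measure on `ℝ^d` carried by the unit sphere with density `w`. -/
def weightMeasure (w : EuclideanSpace ℝ (Fin d) → ℝ) : Measure (EuclideanSpace ℝ (Fin d)) :=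
  (sphMeasure d).withDensity fun x => ENNReal.ofReal (w x)

theorem weightMeasure_real {w : EuclideanSpace ℝ (Fin d) → ℝ} (hw : ∀ x, 0 ≤ w x)
    (hint : Integrable w (sphMeasure d)) {A : Set (EuclideanSpace ℝ (Fin d))}
    (hA : MeasurableSet A) : (weightMeasure w).real A = wMass w A := by
  rw [measureReal_def, weightMeasure, withDensity_apply _ hA, wMass,
    integral_eq_lintegral_of_nonneg_ae (Filter.Eventually.of_forall hw)
      hint.aestronglyMeasurable.restrict]

theorem measurableSet_cap (x : EuclideanSpace ℝ (Fin d)) (r : ℝ) : MeasurableSet (cap x r) := by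
  have hc : Continuous fun y => gdist x y := by
    unfold gdist
    fun_prop
  exact Metric.isClosed_sphere.measurableSet.inter
    (isClosed_le hc continuous_const).measurableSet

/-- Partition of the sphere into geodesic simplexes spanned by
strongly `ε_d`-separated sets with weights in `(1/N)·ℕ`. -/
theorem strongly_separated_simplex_partition (d : ℕ) (hd : 3 ≤ d) :
    ∃ ε δ : ℝ, 0 < ε ∧ 0 < δ ∧
      ∀ w : EuclideanSpace ℝ (Fin d) → ℝ,
        (∀ x, 0 ≤ w x) →
        Integrable w (sphMeasure d) →
        wMass w (unitSphere d) = 1 →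
        (∀ x ∈ unitSphere d, ∀ r : ℝ, 0 < r → 0 < wMass w (cap x r)) →
        ∀ N : ℕ, 0 < N →
          (∀ x ∈ unitSphere d, 1 / (N : ℝ) ≤ wMass w (cap x δ)) →
          ∃ (m : ℕ) (T : Fin m → Fin d → EuclideanSpace ℝ (Fin d)),
            (∀ j, StronglySep ε (T j)) ∧
            (⋃ j, geodSimplex (T j)) = unitSphere d ∧
            (∀ i j, i ≠ j →
              sphInterior (geodSimplex (T i)) ∩ sphInterior (geodSimplex (T j)) = ∅) ∧
            ∀ j, ∃ k : ℕ, 0 < k ∧ (N : ℝ) * wMass w (geodSimplex (T j)) = (k : ℝ) := by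
  obtain ⟨n, hn⟩ := Nat.exists_eq_add_of_le (by omega : 2 ≤ d)
  have hd0 : 0 < d := by omega
  have hdR : (0 : ℝ) < d := by exact_mod_cast hd0
  set K : ℝ := 4 ^ n * (4 * 1)
  set R : ℝ := 4 ^ n * (4 * d)
  have hK0 : 0 < K := by positivity
  have hR0 : 0 < R := by positivity
  refine ⟨1 / (K * R), 1 / (20 * K * R), by positivity, by positivity, ?_⟩
  intro w hw hint hone hpos N hN hcap
  have hδ : 20 * (1 / (20 * K * R)) * K * R ≤ 1 := le_of_eq (by field_simp)
  set δ := 1 / (20 * K * R)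
  have hδ0 : 0 ≤ δ := by positivity
  set ν := weightMeasure w
  have : IsFiniteMeasure ν := isFiniteMeasure_withDensity_ofReal hint.2
  have hreal : ∀ {A : Set (EuclideanSpace ℝ (Fin d))}, MeasurableSet A →
      ν.real A = wMass w A := fun hA => weightMeasure_real hw hint hA
  have hac : ν ≪ sphMeasure d := withDensity_absolutelyContinuous _ _
  have hsph : MeasurableSet (unitSphere d) := Metric.isClosed_sphere.measurableSet
  have hconc : ν (unitSphere d)ᶜ = 0 := by
    refine hac ?_
    rw [sphMeasure, Measure.restrict_apply hsph.compl, compl_inter_self, measure_empty]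
  have hinter : ∀ A, ν.real (A ∩ unitSphere d) = ν.real A := by
    intro A
    rw [measureReal_def, measureReal_def, measure_inter_conull hconc]
  have huniv : ν.real univ = 1 := by
    rw [← hinter, univ_inter, hreal hsph, hone]
  have hcap' : ∀ ξ ∈ unitSphere d, 1 / (N : ℝ) ≤ ν.real (cap ξ δ) := by
    intro ξ hξ
    rw [hreal (measurableSet_cap ξ δ)]
    exact hcap ξ hξ
  have hnull : ∀ f : EuclideanSpace ℝ (Fin d) →ₗ[ℝ] ℝ, f ≠ 0 → ν {x | f x = 0} = 0 :=
    fun f hf => hac (sphMeasure_hyperplane (by omega) f hf)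
  obtain ⟨ι, _, L, hL, hcover, hdisj, hZ⟩ := hasIntegralFan_univ hnull huniv hN hδ0 hcap' hn.symm
    zero_le_one hdR.le coordBound_ofLp hδ
  obtain ⟨m, ⟨e⟩⟩ := Finite.exists_equiv_fin ι
  refine ⟨m, fun j => coneVertex (L (e.symm j)), fun j => (hL _).stronglySep hK0 hR0, ?_, ?_, ?_⟩
  · simp only [geodSimplex_coneVertex]
    rw [← iUnion_inter, e.symm.surjective.iUnion_comp (fun j => coordCone (L j) d), hcover,
      univ_inter]
  · intro i j hij
    rw [eq_empty_iff_forall_notMem]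
    rintro x ⟨⟨hx, r, hr, hri⟩, ⟨-, s, hs, hsj⟩⟩
    simp only [geodSimplex_coneVertex] at hx hri hsj
    have hrs : 0 < min r s / 2 := by positivity
    have hp := hpos x hx.2 _ hrs
    rw [← hreal (measurableSet_cap x _)] at hp
    refine hp.ne' ?_
    rw [measureReal_def, measure_mono_null ?_ (hdisj (e.symm i) (e.symm j)
      (e.symm.injective.ne hij)), ENNReal.toReal_zero]
    intro y hy
    have hyx : dist y x ≤ min r s / 2 := by
      rw [dist_eq_norm]
      exact norm_sub_le_of_mem_cap hx.2 hy
    have hlt : dist y x < min r s := by linarith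
    exact ⟨(hri ⟨hlt.trans_le (min_le_left _ _), hy.1⟩).1,
      (hsj ⟨hlt.trans_le (min_le_right _ _), hy.1⟩).1⟩
  · intro j
    obtain ⟨z, hz⟩ := hZ (e.symm j)
    have hNR : (0 : ℝ) < N := by exact_mod_cast hN
    have hge := (hL (e.symm j)).one_div_le_measureReal_coordCone hd0 hcap' hK0.le hR0.le hδ d
    have hzpos : (0 : ℝ) < z := by
      rw [← hz]
      exact mul_pos hNR ((by positivity : (0 : ℝ) < 1 / N).trans_le hge)
    obtain ⟨k, rfl⟩ := Int.eq_ofNat_of_zero_le (by exact_mod_cast hzpos.le : 0 ≤ z)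
    refine ⟨k, by exact_mod_cast hzpos, ?_⟩
    rw [geodSimplex_coneVertex, ← hreal ((isClosed_coordCone _ _).measurableSet.inter hsph),
      hinter, hz, Int.cast_natCast]
end
end

section
/- Let d ≥ 2 and let R ⊂ S^{d-1} be a closed geodesically convex set with max_{x,y ∈ R} dist(x,y) < π/2. Let P be a real polynomial in d variables and let z_max ∈ R satisfy P(z_max) = max_{z ∈ R} P(z). Then for every x ∈ R: P(z_max) − P(x) ≥ (min_{z ∈ R} ‖∇₀P(z)‖) · dist(x, ∂R), where ∂R is the boundary of R in S^{d-1} and dist(x, ∂R) = inf_{y ∈ ∂R} dist(x,y). -/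
open MeasureTheory Real Set
open scoped InnerProductSpace

noncomputable section

variable {d : ℕ}

/-- Chain rule for the evaluation of a polynomial along a differentiable curve. -/
lemma hasDerivAt_pEval_comp (P : MvPolynomial (Fin d) ℝ) {c : ℝ → EuclideanSpace ℝ (Fin d)}
    {v : EuclideanSpace ℝ (Fin d)} {t : ℝ} (hc : HasDerivAt c v t) :
    HasDerivAt (fun s => pEval P (c s)) ⟪polyGrad P (c t), v⟫_ℝ t := by
  have hcoord (i : Fin d) : HasDerivAt (fun s => c s i) (v i) t :=
    (EuclideanSpace.proj (𝕜 := ℝ) i).hasFDerivAt.comp_hasDerivAt t hc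
  have hinner (Q : MvPolynomial (Fin d) ℝ) : ⟪polyGrad Q (c t), v⟫_ℝ =
      ∑ i, MvPolynomial.eval (fun j => c t j) (MvPolynomial.pderiv i Q) * v i := by
    simp [PiLp.inner_apply, polyGrad, mul_comm]
  rw [hinner]
  induction P using MvPolynomial.induction_on with
  | C a => simpa [pEval] using hasDerivAt_const t a
  | add p q hp hq =>
    simpa [pEval, add_mul, Finset.sum_add_distrib] using HasDerivAt.fun_add hp hq
  | mul_X p k hp =>
    have hmul := hp.mul (hcoord k)
    simp only [pEval, map_mul, MvPolynomial.eval_X]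
    refine hmul.congr_deriv ?_
    simp only [pEval, Derivation.leibniz, MvPolynomial.pderiv_X, smul_eq_mul, map_add, map_mul,
      MvPolynomial.eval_X, add_mul, Finset.sum_add_distrib, Finset.sum_mul, Pi.single_apply]
    rw [add_comm]
    congr 1
    · simp [apply_ite]
    · exact Finset.sum_congr rfl fun i _ => by ring

lemma continuous_pEval (P : MvPolynomial (Fin d) ℝ) : Continuous (pEval P) :=
  (MvPolynomial.continuous_eval P).comp (PiLp.continuous_ofLp 2 _)

lemma gdist_eq_angle {x y : EuclideanSpace ℝ (Fin d)} (hx : x ∈ unitSphere d)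
    (hy : y ∈ unitSphere d) : gdist x y = InnerProductGeometry.angle x y := by
  have hx' : ‖x‖ = 1 := by simpa [unitSphere] using hx
  have hy' : ‖y‖ = 1 := by simpa [unitSphere] using hy
  simp [gdist, InnerProductGeometry.angle, hx', hy']

lemma gdist_triangle {x y z : EuclideanSpace ℝ (Fin d)} (hx : x ∈ unitSphere d)
    (hy : y ∈ unitSphere d) (hz : z ∈ unitSphere d) : gdist x z ≤ gdist x y + gdist y z := by
  rw [gdist_eq_angle hx hy, gdist_eq_angle hy hz, gdist_eq_angle hx hz]
  exact InnerProductGeometry.angle_le_angle_add_angle x y z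

lemma inner_self_tGrad (P : MvPolynomial (Fin d) ℝ) {y : EuclideanSpace ℝ (Fin d)}
    (hy : y ∈ unitSphere d) : ⟪y, tGrad P y⟫_ℝ = 0 := by
  have hy' : ‖y‖ = 1 := by simpa [unitSphere] using hy
  simp [tGrad, inner_sub_right, inner_smul_right, hy']

/-- The great circle through `y` with unit tangent `u` stays on the sphere. -/
lemma greatCircle_mem {y u : EuclideanSpace ℝ (Fin d)} (hy : y ∈ unitSphere d)
    (hu : ‖u‖ = 1) (hyu : ⟪y, u⟫_ℝ = 0) (t : ℝ) : cos t • y + sin t • u ∈ unitSphere d := by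
  have hy' : ‖y‖ = 1 := by simpa [unitSphere] using hy
  have hsq : ‖cos t • y + sin t • u‖ ^ 2 = 1 := by
    rw [norm_add_sq_real]
    simp [norm_smul, inner_smul_left, inner_smul_right, hyu, hy', hu]
  simpa [unitSphere] using (pow_eq_one_iff_of_nonneg (norm_nonneg _) two_ne_zero).1 hsq

lemma gdist_greatCircle {y u : EuclideanSpace ℝ (Fin d)} (hy : y ∈ unitSphere d)
    (hyu : ⟪y, u⟫_ℝ = 0) {t : ℝ} (h0 : 0 ≤ t) (hπ : t ≤ π) :
    gdist y (cos t • y + sin t • u) = t := by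
  have hy' : ‖y‖ = 1 := by simpa [unitSphere] using hy
  simp [gdist, inner_add_right, inner_smul_right, hyu, hy', arccos_cos h0 hπ]

/-- At an interior point of `R`, moving along the tangential gradient increases `P` by more than
`m` times the geodesic distance travelled, for every `m` below the norm of that gradient. -/
lemma exists_pEval_gt_of_lt_norm_tGrad {R : Set (EuclideanSpace ℝ (Fin d))}
    (hRs : R ⊆ unitSphere d) {P : MvPolynomial (Fin d) ℝ} {y : EuclideanSpace ℝ (Fin d)}
    (hy : y ∈ sphInterior R) {m : ℝ} (hm0 : 0 ≤ m) (hm : m < ‖tGrad P y‖) :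
    ∃ z ∈ R, pEval P y + m * gdist y z < pEval P z := by
  obtain ⟨hyR, ε, hε, hball⟩ := hy
  have hyS := hRs hyR
  have hpos : 0 < ‖tGrad P y‖ := hm0.trans_lt hm
  set u := ‖tGrad P y‖⁻¹ • tGrad P y with hudef
  have hu : ‖u‖ = 1 := by
    rw [hudef, norm_smul, norm_inv, norm_norm, inv_mul_cancel₀ hpos.ne']
  have hyu : ⟪y, u⟫_ℝ = 0 := by rw [hudef, inner_smul_right, inner_self_tGrad P hyS, mul_zero]
  have hgu : ⟪polyGrad P y, u⟫_ℝ = ‖tGrad P y‖ := by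
    have hsplit : polyGrad P y = tGrad P y + ⟪y, polyGrad P y⟫_ℝ • y := by simp [tGrad]
    rw [hsplit, inner_add_left, inner_smul_left, hyu, mul_zero, add_zero, hudef,
      inner_smul_right, real_inner_self_eq_norm_sq]
    field_simp
  set c : ℝ → EuclideanSpace ℝ (Fin d) := fun t => cos t • y + sin t • u with hcdef
  have hc0 : c 0 = y := by simp [hcdef]
  have hc : HasDerivAt c u 0 := by
    simpa using ((hasDerivAt_cos 0).smul_const y).fun_add ((hasDerivAt_sin 0).smul_const u)
  have hP := hasDerivAt_pEval_comp P hc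
  rw [hc0, hgu] at hP
  have hslope : ∀ᶠ t in nhdsWithin (0 : ℝ) (Ioi 0),
      m < slope (fun s => pEval P (c s)) 0 t :=
    ((hasDerivAt_iff_tendsto_slope.1 hP).mono_left
      (nhdsWithin_mono _ fun t (ht : 0 < t) => ht.ne')).eventually_const_lt hm
  have hnear : ∀ᶠ t in nhdsWithin (0 : ℝ) (Ioi 0), c t ∈ Metric.ball y ε :=
    (hc.continuousAt.tendsto.mono_left nhdsWithin_le_nhds).eventually
      (hc0.symm ▸ Metric.ball_mem_nhds y hε)
  obtain ⟨t, hts, htb, ht0, htπ⟩ :=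
    (hslope.and (hnear.and (Ioo_mem_nhdsGT pi_pos))).exists
  refine ⟨c t, hball ⟨htb, greatCircle_mem hyS hu hyu t⟩, ?_⟩
  rw [gdist_greatCircle hyS hyu ht0.le htπ.le]
  rw [slope_def_field, hc0, sub_zero, lt_div_iff₀ ht0] at hts
  linarith

/-- Lower bound for the drop of a polynomial on a geodesically
convex set in terms of the tangential gradient and the distance to the boundary. -/
theorem polynomial_drop_lower_bound (d : ℕ) (hd : 2 ≤ d)
    (R : Set (EuclideanSpace ℝ (Fin d))) (hRs : R ⊆ unitSphere d)
    (hRcl : IsClosed R) (hRcv : GeoConvex R)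
    (hdiam : ∀ p ∈ R, ∀ q ∈ R, gdist p q < π / 2)
    (P : MvPolynomial (Fin d) ℝ) (zmax : EuclideanSpace ℝ (Fin d))
    (hzm : zmax ∈ R) (hmax : ∀ z ∈ R, pEval P z ≤ pEval P zmax)
    (x : EuclideanSpace ℝ (Fin d)) (hx : x ∈ R) :
    sInf ((fun z => ‖tGrad P z‖) '' R) * sInf (gdist x '' (R \ sphInterior R))
      ≤ pEval P zmax - pEval P x := by
  set m := sInf ((fun z => ‖tGrad P z‖) '' R)
  set D := sInf (gdist x '' (R \ sphInterior R))
  have hm_le : ∀ z ∈ R, m ≤ ‖tGrad P z‖ := fun z hz =>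
    csInf_le ⟨0, by rintro _ ⟨w, -, rfl⟩; exact norm_nonneg _⟩ ⟨z, hz, rfl⟩
  have hD_le : ∀ z ∈ R \ sphInterior R, D ≤ gdist x z := fun z hz =>
    csInf_le ⟨0, by rintro _ ⟨w, -, rfl⟩; exact arccos_nonneg _⟩ ⟨z, hz, rfl⟩
  have hD0 : 0 ≤ D := Real.sInf_nonneg (by rintro _ ⟨w, -, rfl⟩; exact arccos_nonneg _)
  have hm0 : 0 ≤ m := Real.sInf_nonneg (by rintro _ ⟨w, -, rfl⟩; exact norm_nonneg _)
  have hRc : IsCompact R := (isCompact_sphere 0 1).of_isClosed_subset hRcl hRs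
  -- A maximizer of `P - k * dist(x, ·)` over `R` cannot be interior when `k < m`.
  have hdrop : ∀ k, 0 ≤ k → k < m → k * D ≤ pEval P zmax - pEval P x := by
    intro k hk0 hkm
    have hcont : Continuous fun z => pEval P z - k * gdist x z :=
      (continuous_pEval P).sub
        (continuous_const.mul (continuous_arccos.comp (continuous_const.inner continuous_id)))
    obtain ⟨y, hyR, hymax⟩ := hRc.exists_isMaxOn ⟨x, hx⟩ hcont.continuousOn
    have hyb : y ∉ sphInterior R := by
      intro hyi
      obtain ⟨z, hzR, hz⟩ := exists_pEval_gt_of_lt_norm_tGrad hRs hyi hk0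
        (hkm.trans_le (hm_le y hyR))
      have hle : pEval P z - k * gdist x z ≤ pEval P y - k * gdist x y := hymax hzR
      have htri := mul_le_mul_of_nonneg_left (gdist_triangle (hRs hx) (hRs hyR) (hRs hzR)) hk0
      linarith
    have hle : pEval P x - k * gdist x x ≤ pEval P y - k * gdist x y := hymax hx
    have hxx : gdist x x = 0 := by
      have hx1 : ‖x‖ = 1 := by simpa [unitSphere] using hRs hx
      simp [gdist, hx1]
    have hkD := mul_le_mul_of_nonneg_left (hD_le y ⟨hyR, hyb⟩) hk0
    have hyz := hmax y hyR
    rw [hxx, mul_zero] at hle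
    linarith
  rcases hm0.eq_or_lt with hm | hm
  · rw [← hm, zero_mul, sub_nonneg]
    exact hmax x hx
  · refine le_of_tendsto ((continuous_id.mul continuous_const).tendsto m |>.mono_left
      (nhdsWithin_le_nhds (s := Iio m))) ?_
    filter_upwards [Ioo_mem_nhdsLT hm] with k hk using hdrop k hk.1.le hk.2
end
end

section
/- Let d ≥ 2 and let R ⊂ S^{d-1} be a closed geodesically convex set with max_{p,q ∈ R} dist(p,q) < π/2, and let x₀ be an interior point of R (relative to S^{d-1}). Let T₀ = {y ∈ ℝ^d : x₀·y = 0}. Then: (a) for each y ∈ T₀ \ {0} there is a unique point x_y ∈ R with x_y·y = max_{z ∈ R} z·y; (b) the map y ↦ x_y is continuous on T₀ \ {0}; and (c) for each y ∈ T₀ \ {0} and each w ∈ R \ {x_y}, the function t ↦ y·γ(t) is decreasing on [0,1], where γ(t) = x_y cos(tθ) + ξ sin(tθ) with θ = dist(x_y, w) and ξ = (w − x_y cos θ)/sin θ is the constant-speed geodesic from x_y to w. -/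
open MeasureTheory Real Set
open scoped InnerProductSpace

noncomputable section

variable {d : ℕ}

/-- The normalization of a positive combination of two points of a geodesically convex set
belongs to the set. -/
theorem GeoConvex.normalize_mem {R : Set (EuclideanSpace ℝ (Fin d))} (hR : GeoConvex R)
    {x v : EuclideanSpace ℝ (Fin d)} (hx : x ∈ R) (hv : v ∈ R) {s : ℝ} (hs : 0 ≤ s)
    (hne : x + s • v ≠ 0) : ‖x + s • v‖⁻¹ • (x + s • v) ∈ R := by
  refine hR x hx v hv ⟨?_, ‖x + s • v‖⁻¹, ‖x + s • v‖⁻¹ * s, by positivity, by positivity, ?_⟩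
  · simp only [unitSphere, mem_sphere_iff_norm, sub_zero, norm_smul, norm_inv, norm_norm]
    exact inv_mul_cancel₀ (norm_ne_zero_iff.2 hne)
  · rw [smul_add, smul_smul]

/-- A linear functional vanishing at a relative interior point of a subset of the sphere takes
a positive value on that set. -/
theorem exists_inner_pos_of_mem_sphInterior {R : Set (EuclideanSpace ℝ (Fin d))}
    (hRs : R ⊆ unitSphere d) {x₀ y : EuclideanSpace ℝ (Fin d)} (hx₀ : x₀ ∈ sphInterior R)
    (hxy : ⟪x₀, y⟫_ℝ = 0) (hy : y ≠ 0) : ∃ z ∈ R, 0 < ⟪z, y⟫_ℝ := by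
  obtain ⟨hx₀R, ε, hε, hball⟩ := hx₀
  have hx₀n : ‖x₀‖ = 1 := by simpa [unitSphere] using hRs hx₀R
  have hne : ∀ s : ℝ, x₀ + s • y ≠ 0 := fun s h => by
    have h' : ⟪x₀, x₀ + s • y⟫_ℝ = 0 := by rw [h, inner_zero_right]
    simp [inner_add_right, real_inner_smul_right, hxy, hx₀n] at h'
  have hcont : Continuous fun s : ℝ => ‖x₀ + s • y‖⁻¹ • (x₀ + s • y) :=
    ((by fun_prop : Continuous fun s : ℝ => ‖x₀ + s • y‖).inv₀
      fun s => norm_ne_zero_iff.2 (hne s)).smul (by fun_prop)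
  have hev : ∀ᶠ s : ℝ in nhdsWithin 0 (Ioi 0),
      ‖x₀ + s • y‖⁻¹ • (x₀ + s • y) ∈ Metric.ball x₀ ε := by
    refine (hcont.continuousAt.eventually_mem ?_).filter_mono nhdsWithin_le_nhds
    simpa [hx₀n] using Metric.ball_mem_nhds x₀ hε
  obtain ⟨s, hsball, hs⟩ := (hev.and self_mem_nhdsWithin).exists
  refine ⟨_, hball ⟨hsball, ?_⟩, ?_⟩
  · simp only [unitSphere, mem_sphere_iff_norm, sub_zero, norm_smul, norm_inv, norm_norm]
    exact inv_mul_cancel₀ (norm_ne_zero_iff.2 (hne s))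
  · rw [real_inner_smul_left, inner_add_left, hxy, zero_add, real_inner_smul_left,
      real_inner_self_eq_norm_sq]
    have h1 := norm_pos_iff.2 (hne s)
    have h2 := norm_pos_iff.2 hy
    have h3 : 0 < s := hs
    positivity

/-- The variational inequality at a maximizer of a linear functional over a geodesically
convex set. -/
theorem GeoConvex.inner_le_of_isMax {R : Set (EuclideanSpace ℝ (Fin d))}
    (hRs : R ⊆ unitSphere d) (hR : GeoConvex R) {x v y : EuclideanSpace ℝ (Fin d)}
    (hx : x ∈ R) (hmax : ∀ z ∈ R, ⟪z, y⟫_ℝ ≤ ⟪x, y⟫_ℝ) (hpos : 0 ≤ ⟪x, y⟫_ℝ)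
    (hv : v ∈ R) (hxv : 0 ≤ ⟪x, v⟫_ℝ) : ⟪v, y⟫_ℝ ≤ ⟪x, y⟫_ℝ * ⟪x, v⟫_ℝ := by
  have hxn : ‖x‖ = 1 := by simpa [unitSphere] using hRs hx
  have hvn : ‖v‖ = 1 := by simpa [unitSphere] using hRs hv
  have key : ∀ s : ℝ, 0 < s → ⟪v, y⟫_ℝ ≤ ⟪x, y⟫_ℝ * ⟪x, v⟫_ℝ + s * (⟪x, y⟫_ℝ / 2) := by
    intro s hs
    have hsq : ‖x + s • v‖ ^ 2 = 1 + 2 * s * ⟪x, v⟫_ℝ + s ^ 2 := by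
      rw [norm_add_sq_real, hxn, norm_smul, hvn, real_inner_smul_right, Real.norm_eq_abs,
        mul_one, sq_abs]
      ring
    have hsv : 0 ≤ s * ⟪x, v⟫_ℝ := by positivity
    have hne : x + s • v ≠ 0 := by
      rw [← norm_ne_zero_iff]
      intro h
      rw [h] at hsq
      nlinarith
    have hnpos : 0 < ‖x + s • v‖ := norm_pos_iff.2 hne
    have hle := hmax _ (hR.normalize_mem hx hv hs.le hne)
    rw [real_inner_smul_left, inner_add_left, real_inner_smul_left,
      inv_mul_le_iff₀ hnpos] at hle
    have hn : ‖x + s • v‖ ≤ 1 + s * ⟪x, v⟫_ℝ + s ^ 2 / 2 := by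
      nlinarith [sq_nonneg (‖x + s • v‖ - 1)]
    have := mul_le_mul_of_nonneg_right hn hpos
    nlinarith
  have hlim : Filter.Tendsto (fun s : ℝ => ⟪x, y⟫_ℝ * ⟪x, v⟫_ℝ + s * (⟪x, y⟫_ℝ / 2))
      (nhdsWithin 0 (Ioi 0)) (nhds (⟪x, y⟫_ℝ * ⟪x, v⟫_ℝ)) := by
    refine Filter.Tendsto.mono_left ?_ nhdsWithin_le_nhds
    have h : Continuous fun s : ℝ => ⟪x, y⟫_ℝ * ⟪x, v⟫_ℝ + s * (⟪x, y⟫_ℝ / 2) := by fun_prop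
    simpa using h.tendsto 0
  exact ge_of_tendsto hlim (Filter.eventually_of_mem self_mem_nhdsWithin key)

/-- Lipschitz-type stability of maximizers satisfying the variational inequality. -/
theorem inner_mul_norm_sub_le {x z y y' : EuclideanSpace ℝ (Fin d)} (hx : ‖x‖ = 1)
    (hz : ‖z‖ = 1) (hvar : ⟪z, y⟫_ℝ ≤ ⟪x, y⟫_ℝ * ⟪x, z⟫_ℝ) (hmax : ⟪x, y'⟫_ℝ ≤ ⟪z, y'⟫_ℝ) :
    ⟪x, y⟫_ℝ * ‖z - x‖ ≤ 2 * ‖y' - y‖ := by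
  rcases (norm_nonneg (z - x)).eq_or_lt with h | h
  · rw [← h, mul_zero]
    positivity
  · refine le_of_mul_le_mul_right ?_ h
    have h1 : ‖z - x‖ ^ 2 = 2 - 2 * ⟪x, z⟫_ℝ := by
      rw [norm_sub_sq_real, hx, hz, real_inner_comm]
      ring
    have h2 : ⟪z - x, y' - y⟫_ℝ = ⟪z, y'⟫_ℝ - ⟪z, y⟫_ℝ - (⟪x, y'⟫_ℝ - ⟪x, y⟫_ℝ) := by
      simp only [inner_sub_left, inner_sub_right]
      ring
    have h3 := real_inner_le_norm (z - x) (y' - y)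
    have h4 : ⟪x, y⟫_ℝ * ‖z - x‖ ^ 2 = 2 * (⟪x, y⟫_ℝ - ⟪x, y⟫_ℝ * ⟪x, z⟫_ℝ) := by
      rw [h1]
      ring
    nlinarith

/-- A nonnegative multiple of cosine plus a nonpositive multiple of sine decreases on the
first quadrant. -/
theorem antitoneOn_cos_mul_add_sin_mul {a b θ : ℝ} (ha : 0 ≤ a) (hb : b ≤ 0) (hθ : 0 ≤ θ)
    (hθ' : θ ≤ π / 2) :
    AntitoneOn (fun t : ℝ => Real.cos (t * θ) * a + Real.sin (t * θ) * b) (Icc 0 1) := by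
  intro t ht u hu htu
  have h0 : 0 ≤ t * θ := mul_nonneg ht.1 hθ
  have h1 : t * θ ≤ u * θ := mul_le_mul_of_nonneg_right htu hθ
  have h2 : u * θ ≤ θ := mul_le_of_le_one_left hθ hu.2
  have hcos := Real.cos_le_cos_of_nonneg_of_le_pi h0 (by linarith [Real.pi_pos]) h1
  have hsin := Real.sin_le_sin_of_le_of_le_pi_div_two (by linarith [Real.pi_pos])
    (h2.trans hθ') h1
  exact add_le_add (mul_le_mul_of_nonneg_right hcos ha) (mul_le_mul_of_nonpos_right hsin hb)

/-- Existence, uniqueness and continuity of the supporting point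
`x_y` maximizing `z ↦ z⬝y` over a geodesically convex set, together with the
monotonicity of `t ↦ y ⬝ γ(t)` along geodesics emanating from `x_y`. -/
theorem supporting_point_lemma (d : ℕ) (hd : 2 ≤ d)
    (R : Set (EuclideanSpace ℝ (Fin d))) (hRs : R ⊆ unitSphere d)
    (hRcl : IsClosed R) (hRcv : GeoConvex R)
    (hdiam : ∀ p ∈ R, ∀ q ∈ R, gdist p q < π / 2)
    (x₀ : EuclideanSpace ℝ (Fin d)) (hx₀ : x₀ ∈ sphInterior R) :
    (∀ y : EuclideanSpace ℝ (Fin d), ⟪x₀, y⟫_ℝ = 0 → y ≠ 0 →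
      ∃! x, x ∈ R ∧ ∀ z ∈ R, ⟪z, y⟫_ℝ ≤ ⟪x, y⟫_ℝ) ∧
    ∃ F : EuclideanSpace ℝ (Fin d) → EuclideanSpace ℝ (Fin d),
      (∀ y : EuclideanSpace ℝ (Fin d), ⟪x₀, y⟫_ℝ = 0 → y ≠ 0 →
        F y ∈ R ∧ ∀ z ∈ R, ⟪z, y⟫_ℝ ≤ ⟪F y, y⟫_ℝ) ∧
      ContinuousOn F ({y : EuclideanSpace ℝ (Fin d) | ⟪x₀, y⟫_ℝ = 0} \ {0}) ∧
      ∀ y : EuclideanSpace ℝ (Fin d), ⟪x₀, y⟫_ℝ = 0 → y ≠ 0 →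
        ∀ v ∈ R, v ≠ F y →
          AntitoneOn (fun t : ℝ =>
              ⟪y, Real.cos (t * gdist (F y) v) • F y
                + Real.sin (t * gdist (F y) v) •
                  ((Real.sin (gdist (F y) v))⁻¹ •
                    (v - Real.cos (gdist (F y) v) • F y))⟫_ℝ)
            (Set.Icc (0 : ℝ) 1) := by
  have hn : ∀ x ∈ R, ‖x‖ = 1 := fun x hx => by simpa [unitSphere] using hRs hx
  have hinner : ∀ p ∈ R, ∀ q ∈ R, 0 < ⟪p, q⟫_ℝ := fun p hp q hq =>
    Real.arccos_lt_pi_div_two.1 (hdiam p hp q hq)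
  have hcpt : IsCompact R :=
    (isCompact_sphere (0 : EuclideanSpace ℝ (Fin d)) 1).of_isClosed_subset hRcl hRs
  have hex : ∀ y : EuclideanSpace ℝ (Fin d), ⟪x₀, y⟫_ℝ = 0 → y ≠ 0 →
      ∃ x, x ∈ R ∧ ∀ z ∈ R, ⟪z, y⟫_ℝ ≤ ⟪x, y⟫_ℝ := fun y _ _ =>
    hcpt.exists_isMaxOn ⟨x₀, hx₀.1⟩
      (by fun_prop : ContinuousOn (fun z : EuclideanSpace ℝ (Fin d) => ⟪z, y⟫_ℝ) R)
  have hpos : ∀ x y : EuclideanSpace ℝ (Fin d), ⟪x₀, y⟫_ℝ = 0 → y ≠ 0 →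
      (∀ z ∈ R, ⟪z, y⟫_ℝ ≤ ⟪x, y⟫_ℝ) → 0 < ⟪x, y⟫_ℝ := fun x y hy hy0 hmax =>
    let ⟨z, hz, hzy⟩ := exists_inner_pos_of_mem_sphInterior hRs hx₀ hy hy0
    hzy.trans_le (hmax z hz)
  have hvar : ∀ x y : EuclideanSpace ℝ (Fin d), ⟪x₀, y⟫_ℝ = 0 → y ≠ 0 → x ∈ R →
      (∀ z ∈ R, ⟪z, y⟫_ℝ ≤ ⟪x, y⟫_ℝ) → ∀ v ∈ R, ⟪v, y⟫_ℝ ≤ ⟪x, y⟫_ℝ * ⟪x, v⟫_ℝ :=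
    fun x y hy hy0 hx hmax v hv => hRcv.inner_le_of_isMax hRs hx hmax
      (hpos x y hy hy0 hmax).le hv (hinner x hx v hv).le
  refine ⟨fun y hy hy0 => ?_, ?_⟩
  · obtain ⟨x, hx, hmax⟩ := hex y hy hy0
    refine ⟨x, ⟨hx, hmax⟩, fun z ⟨hz, hzmax⟩ => ?_⟩
    have h := inner_mul_norm_sub_le (hn x hx) (hn z hz) (hvar x y hy hy0 hx hmax z hz)
      (hzmax x hx)
    rw [sub_self, norm_zero, mul_zero] at h
    exact sub_eq_zero.1 (norm_le_zero_iff.1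
      (nonpos_of_mul_nonpos_right h (hpos x y hy hy0 hmax)))
  choose! F hF using hex
  refine ⟨F, hF, ?_, fun y hy hy0 v hv _ => ?_⟩
  · intro y ⟨hy, hy0⟩
    obtain ⟨hFR, hFmax⟩ := hF y hy hy0
    have hM := hpos _ y hy hy0 hFmax
    refine tendsto_iff_norm_sub_tendsto_zero.2 (squeeze_zero'
      (g := fun y' => 2 * ‖y' - y‖ / ⟪F y, y⟫_ℝ)
      (Filter.Eventually.of_forall fun _ => norm_nonneg _) ?_ ?_)
    · filter_upwards [self_mem_nhdsWithin] with y' ⟨hy', hy0'⟩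
      obtain ⟨hFR', hFmax'⟩ := hF y' hy' hy0'
      rw [le_div_iff₀' hM]
      exact inner_mul_norm_sub_le (hn _ hFR) (hn _ hFR')
        (hvar _ y hy hy0 hFR hFmax _ hFR') (hFmax' _ hFR)
    · refine Filter.Tendsto.mono_left ?_ nhdsWithin_le_nhds
      have h : Continuous fun y' => 2 * ‖y' - y‖ / ⟪F y, y⟫_ℝ := by fun_prop
      simpa using h.tendsto y
  · obtain ⟨hFR, hFmax⟩ := hF y hy hy0
    have hθ : 0 ≤ gdist (F y) v := Real.arccos_nonneg _
    have hcos : Real.cos (gdist (F y) v) = ⟪F y, v⟫_ℝ := by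
      have h := hinner _ hFR v hv
      have h1 := real_inner_le_norm (F y) v
      rw [hn _ hFR, hn v hv, mul_one] at h1
      exact Real.cos_arccos (by linarith) h1
    have hsin : 0 ≤ Real.sin (gdist (F y) v) :=
      Real.sin_nonneg_of_nonneg_of_le_pi hθ (Real.arccos_le_pi _)
    have hb : ⟪y, (Real.sin (gdist (F y) v))⁻¹ •
        (v - Real.cos (gdist (F y) v) • F y)⟫_ℝ ≤ 0 := by
      have h := hvar _ y hy hy0 hFR hFmax v hv
      rw [real_inner_smul_right, inner_sub_right, real_inner_smul_right, hcos,
        real_inner_comm v y, real_inner_comm (F y) y]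
      exact mul_nonpos_of_nonneg_of_nonpos (inv_nonneg.2 hsin) (by linarith)
    have ha : 0 ≤ ⟪y, F y⟫_ℝ := by
      rw [real_inner_comm]
      exact (hpos _ y hy hy0 hFmax).le
    simpa only [inner_add_right, real_inner_smul_right] using
      antitoneOn_cos_mul_add_sin_mul ha hb hθ (hdiam _ hFR v hv).le
end
end

section
/- There exist absolute constants 0 < c ≤ C such that the following holds for every d ≥ 2. Let z, ξ_1, ξ_2 ∈ S^{d-1} with ξ_1·z = ξ_2·z = 0, let θ_1, θ_2 ∈ (0, π/4], and define γ_i(t) = z cos(θ_i t) + ξ_i sin(θ_i t) for i = 1, 2. Then for every t ∈ (0,1): c · t · ‖γ_1(1) − γ_2(1)‖ ≤ ‖γ_1(t) − γ_2(t)‖ ≤ C · t · ‖γ_1(1) − γ_2(1)‖. -/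
open MeasureTheory Real Set
open scoped InnerProductSpace

noncomputable section

variable {d : ℕ}

theorem mul_sin_le_sin_mul {x t : ℝ} (hx : 0 ≤ x) (hx' : x ≤ π) (ht : 0 ≤ t) (ht' : t ≤ 1) :
    t * Real.sin x ≤ Real.sin (x * t) := by
  have h := strictConcaveOn_sin_Icc.concaveOn.2 (x := x) (y := 0) ⟨hx, hx'⟩
    ⟨le_rfl, Real.pi_pos.le⟩ ht (sub_nonneg.2 ht') (by ring)
  simpa [mul_comm] using h

theorem sin_mul_le_two_mul_mul_sin {x t : ℝ} (hx : 0 ≤ x) (hx' : x ≤ π / 2) (ht : 0 ≤ t) :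
    Real.sin (x * t) ≤ 2 * t * Real.sin x := by
  have hsin : x ≤ 2 * Real.sin x := by
    have h := Real.mul_le_sin hx hx'
    have h2 : 1 / 2 ≤ 2 / π := by
      rw [div_le_div_iff₀ two_pos Real.pi_pos]
      linarith [Real.pi_le_four]
    nlinarith
  calc Real.sin (x * t) ≤ x * t := Real.sin_le (by positivity)
    _ ≤ 2 * Real.sin x * t := by gcongr
    _ = 2 * t * Real.sin x := by ring

theorem sin_mul_sq_bounds {x t : ℝ} (hx : |x| ≤ π / 2) (ht : 0 ≤ t) (ht' : t ≤ 1) :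
    t ^ 2 * Real.sin x ^ 2 ≤ Real.sin (x * t) ^ 2 ∧
      Real.sin (x * t) ^ 2 ≤ 4 * t ^ 2 * Real.sin x ^ 2 := by
  wlog h0 : 0 ≤ x generalizing x
  · simpa using this (x := -x) (by simpa using hx) (by linarith)
  rw [abs_of_nonneg h0] at hx
  have hπ : x ≤ π := by linarith [Real.pi_pos]
  have h1 := mul_sin_le_sin_mul h0 hπ ht ht'
  have h2 := sin_mul_le_two_mul_mul_sin h0 hx ht
  have h3 : 0 ≤ t * Real.sin x := mul_nonneg ht (Real.sin_nonneg_of_nonneg_of_le_pi h0 hπ)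
  constructor <;> nlinarith

theorem norm_sq_geodesic_sub {E : Type*} [NormedAddCommGroup E] [InnerProductSpace ℝ E]
    {z ξ₁ ξ₂ : E} (hz : ‖z‖ = 1) (h₁ : ‖ξ₁‖ = 1) (h₂ : ‖ξ₂‖ = 1)
    (hz₁ : ⟪ξ₁, z⟫_ℝ = 0) (hz₂ : ⟪ξ₂, z⟫_ℝ = 0) (a b : ℝ) :
    ‖(Real.cos a • z + Real.sin a • ξ₁) - (Real.cos b • z + Real.sin b • ξ₂)‖ ^ 2
      = 4 * Real.sin ((a - b) / 2) ^ 2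
        + 2 * (1 - ⟪ξ₁, ξ₂⟫_ℝ) * (Real.sin a * Real.sin b) := by
  have hz₁' : ⟪z, ξ₁⟫_ℝ = 0 := by rw [real_inner_comm, hz₁]
  have hz₂' : ⟪z, ξ₂⟫_ℝ = 0 := by rw [real_inner_comm, hz₂]
  have hhalf : Real.sin ((a - b) / 2) ^ 2 = 1 / 2 - Real.cos (a - b) / 2 := by
    rw [Real.sin_sq_eq_half_sub]
    ring_nf
  rw [hhalf, Real.cos_sub, ← real_inner_self_eq_norm_sq]
  simp only [inner_sub_left, inner_sub_right, inner_add_left, inner_add_right,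
    real_inner_smul_left, real_inner_smul_right, real_inner_self_eq_norm_sq,
    norm_smul, mul_pow, Real.norm_eq_abs, sq_abs, hz, h₁, h₂, hz₁, hz₂, hz₁', hz₂', real_inner_comm ξ₁ ξ₂]
  linear_combination Real.sin_sq_add_cos_sq a + Real.sin_sq_add_cos_sq b

/-- Two geodesics emanating from a common point `z` at angles
`θ₁, θ₂ ≤ π/4` separate at a linear rate. -/
theorem geodesic_separation_rate :
    ∃ c C : ℝ, 0 < c ∧ c ≤ C ∧
      ∀ d : ℕ, 2 ≤ d →
      ∀ z ξ₁ ξ₂ : EuclideanSpace ℝ (Fin d),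
        z ∈ unitSphere d → ξ₁ ∈ unitSphere d → ξ₂ ∈ unitSphere d →
        ⟪ξ₁, z⟫_ℝ = 0 → ⟪ξ₂, z⟫_ℝ = 0 →
        ∀ θ₁ θ₂ : ℝ, θ₁ ∈ Set.Ioc (0 : ℝ) (π / 4) → θ₂ ∈ Set.Ioc (0 : ℝ) (π / 4) →
        ∀ t : ℝ, t ∈ Set.Ioo (0 : ℝ) 1 →
          c * t * ‖(Real.cos θ₁ • z + Real.sin θ₁ • ξ₁)
              - (Real.cos θ₂ • z + Real.sin θ₂ • ξ₂)‖
            ≤ ‖(Real.cos (θ₁ * t) • z + Real.sin (θ₁ * t) • ξ₁)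
              - (Real.cos (θ₂ * t) • z + Real.sin (θ₂ * t) • ξ₂)‖ ∧
          ‖(Real.cos (θ₁ * t) • z + Real.sin (θ₁ * t) • ξ₁)
              - (Real.cos (θ₂ * t) • z + Real.sin (θ₂ * t) • ξ₂)‖
            ≤ C * t * ‖(Real.cos θ₁ • z + Real.sin θ₁ • ξ₁)
              - (Real.cos θ₂ • z + Real.sin θ₂ • ξ₂)‖ := by
  refine ⟨1, 2, one_pos, one_le_two, ?_⟩
  intro d _ z ξ₁ ξ₂ hz h₁ h₂ hz₁ hz₂ θ₁ θ₂ hθ₁ hθ₂ t ht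
  replace hz : ‖z‖ = 1 := by simpa [unitSphere] using hz
  replace h₁ : ‖ξ₁‖ = 1 := by simpa [unitSphere] using h₁
  replace h₂ : ‖ξ₂‖ = 1 := by simpa [unitSphere] using h₂
  obtain ⟨hθ₁0, hθ₁⟩ := hθ₁
  obtain ⟨hθ₂0, hθ₂⟩ := hθ₂
  obtain ⟨ht0, ht1⟩ := ht
  have hπ := Real.pi_pos
  have hdist := norm_sq_geodesic_sub hz h₁ h₂ hz₁ hz₂
  have hv : 0 ≤ 2 * (1 - ⟪ξ₁, ξ₂⟫_ℝ) := by
    have h := real_inner_le_norm ξ₁ ξ₂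
    rw [h₁, h₂] at h
    linarith
  have hD := hdist θ₁ θ₂
  have hDt := hdist (θ₁ * t) (θ₂ * t)
  rw [show (θ₁ * t - θ₂ * t) / 2 = (θ₁ - θ₂) / 2 * t by ring] at hDt
  obtain ⟨hlow, hupp⟩ := sin_mul_sq_bounds (x := (θ₁ - θ₂) / 2) (t := t)
    (by rw [abs_le]; constructor <;> linarith) ht0.le ht1.le
  have hs₁ : 0 ≤ Real.sin θ₁ := Real.sin_nonneg_of_nonneg_of_le_pi hθ₁0.le (by linarith)
  have hs₂ : 0 ≤ Real.sin θ₂ := Real.sin_nonneg_of_nonneg_of_le_pi hθ₂0.le (by linarith)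
  have hl₁ := mul_sin_le_sin_mul hθ₁0.le (by linarith) ht0.le ht1.le
  have hl₂ := mul_sin_le_sin_mul hθ₂0.le (by linarith) ht0.le ht1.le
  have hu₁ := sin_mul_le_two_mul_mul_sin hθ₁0.le (by linarith) ht0.le
  have hu₂ := sin_mul_le_two_mul_mul_sin hθ₂0.le (by linarith) ht0.le
  have hst₁ : 0 ≤ Real.sin (θ₁ * t) := (mul_nonneg ht0.le hs₁).trans hl₁
  have hst₂ : 0 ≤ Real.sin (θ₂ * t) := (mul_nonneg ht0.le hs₂).trans hl₂
  have hplow := mul_le_mul_of_nonneg_left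
    (mul_le_mul hl₁ hl₂ (mul_nonneg ht0.le hs₂) hst₁) hv
  have hpupp := mul_le_mul_of_nonneg_left
    (mul_le_mul hu₁ hu₂ hst₂ (mul_nonneg (by positivity) hs₁)) hv
  constructor
  · refine (sq_le_sq₀ (by positivity) (by positivity)).1 ?_
    rw [mul_pow, hD, hDt]
    linarith
  · refine (sq_le_sq₀ (by positivity) (by positivity)).1 ?_
    rw [mul_pow, hD, hDt]
    linarith
end
end
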